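/- arXiv:1112.2161 — 3 statements merged into one kernel-verified Lean document; each statement's English description precedes it below -/
import Mathlib

section
/- Let R be a Noetherian commutative ring of prime characteristic p > 0. Suppose that for every prime ideal Q of R the Frobenius acts injectively on the Q-power-torsion of the localization R_Q; that is, every element x ∈ R_Q such that x^p = 0 and (Q·R_Q)^n · x = 0 for some n ≥ 1 must satisfy x = 0. Then R is reduced. -/
/-- If for every prime ideal `Q` of a Noetherian ring `R` of prime characteristic `p`,
the Frobenius acts injectively on the `Q`-power-torsion of `R_Q`
(i.e. `x ^ p = 0` and `(Q R_Q)^n • x = 0` for some `n ≥ 1` imply `x = 0`),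
then `R` is reduced. -/
theorem fInjective_implies_reduced (R : Type*) [CommRing R] [IsNoetherianRing R]
    (p : ℕ) (hp : p.Prime) [CharP R p]
    (H : ∀ (Q : Ideal R) [Q.IsPrime], ∀ x : Localization.AtPrime Q,
      x ^ p = 0 →
      (∃ n : ℕ, 1 ≤ n ∧
        ∀ a ∈ (Q.map (algebraMap R (Localization.AtPrime Q))) ^ n, a * x = 0) →
      x = 0) :
    IsReduced R := by
  rw [← nilradical_eq_bot_iff, Submodule.eq_bot_iff]
  intro x hx
  by_contra hx0
  obtain ⟨Q, hQ, -⟩ := exists_le_isAssociatedPrime_of_isNoetherianRing R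
    (⟨x, hx⟩ : nilradical R) (by simpa [Subtype.ext_iff] using hx0)
  obtain ⟨hQp, ⟨y, hy⟩, hQy⟩ := isAssociatedPrime_iff.mp hQ
  have mem_iff (r : R) : r ∈ Q ↔ r * y = 0 := by
    rw [hQy, Submodule.mem_colon_singleton, Submodule.mem_bot, Subtype.ext_iff]
    rfl
  have hyy : y * y = 0 := (mem_iff y).mp (nilradical_le_prime Q hy)
  have hyp : y ^ p = 0 := pow_eq_zero_of_le hp.two_le (by rw [sq, hyy])
  have hloc : algebraMap R (Localization.AtPrime Q) y = 0 := by
    refine H Q _ (by rw [← map_pow, hyp, map_zero]) ⟨1, le_rfl, fun a ha => ?_⟩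
    rw [pow_one] at ha
    induction ha using Submodule.span_induction with
    | mem a ha =>
      obtain ⟨r, hr, rfl⟩ := ha
      rw [← map_mul, (mem_iff r).mp hr, map_zero]
    | zero => exact zero_mul _
    | add a b _ _ iha ihb => rw [add_mul, iha, ihb, add_zero]
    | smul c a _ iha => rw [smul_mul_assoc, iha, smul_zero]
  obtain ⟨s, hs⟩ := (IsLocalization.map_eq_zero_iff Q.primeCompl _ y).mp hloc
  exact s.2 ((mem_iff s).mpr hs)
end

section
/- Let p be a prime and let f : R → S be a flat ring homomorphism of F-finite Noetherian commutative rings of characteristic p with regular fibers, i.e. for every prime ideal 𝔮 of S with 𝔭 = f^{-1}(𝔮), the localization of the fiber ring S ⊗_R κ(𝔭) at the prime corresponding to 𝔮 is a regular local ring (here κ(𝔭) denotes the residue field of R_𝔭). If R is F-pure, then S is F-pure. -/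
/-- A ring `R` of prime characteristic `p` is `F`-pure (Frobenius split) if there is an
`R`-linear map `F_* R → R` sending `1` to `1`, i.e. an additive map `φ : R → R` with
`φ (r ^ p * x) = r * φ x` and `φ 1 = 1`. -/
def IsFPure (p : ℕ) (R : Type*) [CommRing R] : Prop :=
  ∃ φ : R →+ R, (∀ r x : R, φ (r ^ p * x) = r * φ x) ∧ φ 1 = 1

/-- A ring `R` of prime characteristic `p` is `F`-finite if `F_* R`, i.e. `R` viewed as an
`R`-module via the Frobenius, is a finitely generated `R`-module. -/
def IsFFinite (p : ℕ) (R : Type*) [CommRing R] : Prop :=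
  ∃ s : Finset R, ∀ x : R, ∃ c : R → R, x = ∑ y ∈ s, c y ^ p * y

/-- A commutative ring is a regular local ring if it is Noetherian, local, and its
maximal ideal (equivalently, the Jacobson radical) is generated by `Krull dim` many
elements. -/
def IsRegularLocal (A : Type*) [CommRing A] : Prop :=
  IsNoetherianRing A ∧ IsLocalRing A ∧
    ∃ s : Finset A, Ideal.span (s : Set A) = (⊥ : Ideal A).jacobson ∧
      (s.card : WithBot (WithTop ℕ)) = ringKrullDim A

/-- Every `T`-linear map from the submodule `K` of `P` to `X` extends to `P`. -/
def ExtendsFrom {T P : Type*} [CommRing T] [AddCommGroup P] [Module T P] (K : Submodule T P)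
    (X : Type*) [AddCommGroup X] [Module T X] : Prop :=
  ∀ γ : K →ₗ[T] X, ∃ G : P →ₗ[T] X, G ∘ₗ K.subtype = γ

section Extension

variable {T P : Type*} [CommRing T] [AddCommGroup P] [Module T P] {K : Submodule T P}
  {X X' X'' : Type*} [AddCommGroup X] [Module T X] [AddCommGroup X'] [Module T X']
  [AddCommGroup X''] [Module T X'']

theorem ExtendsFrom.of_equiv (h : ExtendsFrom K X) (e : X ≃ₗ[T] X') : ExtendsFrom K X' := by
  intro γ
  obtain ⟨G, hG⟩ := h (e.symm.toLinearMap ∘ₗ γ)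
  refine ⟨e.toLinearMap ∘ₗ G, ?_⟩
  rw [LinearMap.comp_assoc, hG]
  ext x
  simp

/-- If a map `γ` from `K` vanishes after composing with `g`, it extends as soon as all maps
to `ker g` do. -/
theorem ExtendsFrom.exists_of_comp_eq_zero (h' : ExtendsFrom K X') {f : X' →ₗ[T] X}
    {g : X →ₗ[T] X''} (hf : Function.Injective f) (hfg : Function.Exact f g) (γ : K →ₗ[T] X)
    (hγ : g ∘ₗ γ = 0) : ∃ G : P →ₗ[T] X, G ∘ₗ K.subtype = γ ∧ g ∘ₗ G = 0 := by
  have hr : ∀ x, γ x ∈ LinearMap.range f := fun x => by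
    rw [LinearMap.mem_range]
    exact (hfg _).1 (LinearMap.congr_fun hγ x)
  obtain ⟨G, hG⟩ := h' ((LinearEquiv.ofInjective f hf).symm.toLinearMap ∘ₗ γ.codRestrict _ hr)
  refine ⟨f ∘ₗ G, ?_, ?_⟩
  · rw [LinearMap.comp_assoc, hG]
    ext x
    simp
  · ext x
    exact hfg.apply_apply_eq_zero _

theorem ExtendsFrom.of_exact [Module.Projective T P] (h' : ExtendsFrom K X')
    (h'' : ExtendsFrom K X'') {f : X' →ₗ[T] X} {g : X →ₗ[T] X''} (hf : Function.Injective f)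
    (hfg : Function.Exact f g) (hg : Function.Surjective g) : ExtendsFrom K X := by
  intro γ
  obtain ⟨G, hG⟩ := h'' (g ∘ₗ γ)
  obtain ⟨H, hH⟩ := Module.projective_lifting_property g G hg
  obtain ⟨D, hD, -⟩ := h'.exists_of_comp_eq_zero hf hfg (γ - H ∘ₗ K.subtype) (by
    rw [LinearMap.comp_sub, ← LinearMap.comp_assoc, hH, hG, sub_self])
  refine ⟨H + D, ?_⟩
  rw [LinearMap.add_comp, hD, add_sub_cancel]

/-- Maps out of `P / K` lift along surjections whose kernel has the extension property. -/
theorem ExtendsFrom.exists_lift [Module.Projective T P] (h' : ExtendsFrom K X')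
    {f : X' →ₗ[T] X} {g : X →ₗ[T] X''} (hf : Function.Injective f)
    (hfg : Function.Exact f g) (hg : Function.Surjective g) (G : P →ₗ[T] X'')
    (hG : G ∘ₗ K.subtype = 0) : ∃ H : P →ₗ[T] X, H ∘ₗ K.subtype = 0 ∧ g ∘ₗ H = G := by
  obtain ⟨H, hH⟩ := Module.projective_lifting_property g G hg
  obtain ⟨D, hD, hD'⟩ := h'.exists_of_comp_eq_zero hf hfg (H ∘ₗ K.subtype) (by
    rw [← LinearMap.comp_assoc, hH, hG])
  refine ⟨H - D, ?_, ?_⟩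
  · rw [LinearMap.sub_comp, hD, sub_self]
  · rw [LinearMap.comp_sub, hH, hD', sub_zero]

end Extension

section ArtinRees

variable {T : Type*} [CommRing T]

theorem LinearMap.mem_smul_top_of_forall_mem {n : ℕ} {J : Ideal T} (f : (Fin n → T) →ₗ[T] T)
    (hf : ∀ x, f x ∈ J) : f ∈ J • (⊤ : Submodule T ((Fin n → T) →ₗ[T] T)) := by
  have : f = ∑ i, f (Pi.single i 1) • LinearMap.proj (R := T) (φ := fun _ => T) i := by
    ext i
    simp [Pi.single_apply]
  rw [this]
  exact Submodule.sum_mem _ fun i _ => Submodule.smul_mem_smul (hf _) trivial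

theorem LinearMap.apply_mem_of_mem_smul_top {P : Type*} [AddCommGroup P] [Module T P]
    {J : Ideal T} {f : P →ₗ[T] T} (hf : f ∈ J • (⊤ : Submodule T (P →ₗ[T] T))) (x : P) :
    f x ∈ J := by
  induction hf using Submodule.smul_induction_on' with
  | smul r hr g _ => exact J.mul_mem_right _ hr
  | add g _ g' _ h h' => exact J.add_mem h h'

/-- A functional on `P` that vanishes on `K` modulo a high power of `J` agrees modulo `J` with
a functional that vanishes on `K`. -/
theorem exists_pow_forall_exists_congr [IsNoetherianRing T] {n : ℕ}
    (K : Submodule T (Fin n → T)) (J : Ideal T) : ∃ t : ℕ, ∀ g : (Fin n → T) →ₗ[T] T,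
      (∀ x ∈ K, g x ∈ J ^ t) →
        ∃ h : (Fin n → T) →ₗ[T] T, (∀ x ∈ K, h x = 0) ∧ ∀ x, g x - h x ∈ J := by
  obtain ⟨l, u, hu⟩ := Module.Finite.exists_fin' T K
  let ρ : ((Fin n → T) →ₗ[T] T) →ₗ[T] ((Fin l → T) →ₗ[T] T) :=
    LinearMap.lcomp T T (K.subtype ∘ₗ u)
  obtain ⟨k, hk⟩ := Ideal.exists_pow_inf_eq_pow_smul J (LinearMap.range ρ)
  refine ⟨k + 1, fun g hg => ?_⟩
  have h1 : ρ g ∈ J ^ (k + 1) • (⊤ : Submodule T ((Fin l → T) →ₗ[T] T)) :=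
    LinearMap.mem_smul_top_of_forall_mem _ fun x => hg _ (u x).2
  have h2 : ρ g ∈ J • LinearMap.range ρ := by
    have h3 : ρ g ∈ J ^ (k + 1) • (⊤ : Submodule T ((Fin l → T) →ₗ[T] T)) ⊓ LinearMap.range ρ :=
      ⟨h1, g, rfl⟩
    rw [hk (k + 1) (Nat.le_succ k), Nat.add_sub_cancel_left, pow_one] at h3
    exact Submodule.smul_mono le_rfl inf_le_right h3
  rw [LinearMap.range_eq_map, ← Submodule.map_smul''] at h2
  obtain ⟨g', hg', hgg'⟩ := h2
  refine ⟨g - g', fun x hx => ?_, fun x => ?_⟩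
  · obtain ⟨y, hy⟩ := hu ⟨x, hx⟩
    have := LinearMap.congr_fun hgg' y
    simp only [ρ, LinearMap.lcomp_apply, LinearMap.comp_apply, hy, Submodule.subtype_apply] at this
    simp [this]
  · simpa using LinearMap.apply_mem_of_mem_smul_top hg' x

end ArtinRees

section Flat

theorem Submodule.mem_smul_ker_of_flat {R P M : Type*} [CommRing R]
    [AddCommGroup P] [Module R P] [AddCommGroup M] [Module R M] [Module.Flat R M]
    (φ : P →ₗ[R] M) (hφ : Function.Surjective φ) {J : Ideal R} {x : P} (hx : φ x = 0)
    (hxJ : x ∈ J • (⊤ : Submodule R P)) : x ∈ J • LinearMap.ker φ := by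
  rw [← Submodule.span_univ, ← Set.image_id Set.univ,
    Submodule.mem_ideal_smul_span_iff_exists_sum'] at hxJ
  obtain ⟨a, ha, rfl⟩ := hxJ
  have hrel : ∑ i : a.support, a i • φ (i : (Set.univ : Set P)) = 0 := by
    rw [← hx, Finsupp.sum, map_sum, ← Finset.sum_coe_sort a.support]
    simp
  obtain ⟨k, c, y, hy, hc⟩ := Module.Flat.isTrivialRelation_of_sum_smul_eq_zero hrel
  choose q hq using fun j => hφ (y j)
  have key : (a.sum fun i c => c • id (i : P)) =
      ∑ i : a.support, a i • ((i : (Set.univ : Set P)) - ∑ j, c i j • q j : P) := by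
    have h0 : ∑ i : a.support, a i • ∑ j, c i j • q j = 0 := by
      simp_rw [Finset.smul_sum, smul_smul]
      rw [Finset.sum_comm]
      simp_rw [← Finset.sum_smul, hc, zero_smul, Finset.sum_const_zero]
    simp_rw [smul_sub, Finset.sum_sub_distrib, h0, sub_zero]
    rw [Finsupp.sum, ← Finset.sum_coe_sort a.support]
    rfl
  rw [key]
  refine Submodule.sum_mem _ fun i _ => Submodule.smul_mem_smul (ha _) ?_
  have hyi : φ (i : (Set.univ : Set P)) = ∑ j, c i j • y j := hy i
  simp [hyi, hq]

end Flat

section FiniteLength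

theorem IsLocalRing.isFiniteLength_quotient_maximalIdeal_pow (R : Type*) [CommRing R]
    [IsLocalRing R] [IsNoetherianRing R] (t : ℕ) :
    IsFiniteLength R (R ⧸ IsLocalRing.maximalIdeal R ^ t) := by
  rw [isFiniteLength_iff_isNoetherian_isArtinian]
  refine ⟨inferInstance, ?_⟩
  rcases subsingleton_or_nontrivial (R ⧸ IsLocalRing.maximalIdeal R ^ t) with h | h
  · infer_instance
  have hsurj := Ideal.Quotient.mk_surjective (I := IsLocalRing.maximalIdeal R ^ t)
  have := IsLocalRing.of_surjective' _ hsurj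
  have hart : IsArtinianRing (R ⧸ IsLocalRing.maximalIdeal R ^ t) := by
    rw [isArtinianRing_iff_isNilpotent_maximalIdeal]
    refine ⟨t, ?_⟩
    rw [← IsLocalRing.map_maximalIdeal_of_surjective _ hsurj, ← Ideal.map_pow,
      Ideal.map_quotient_self]
    rfl
  exact isArtinian_of_surjective_algebraMap (R := R ⧸ IsLocalRing.maximalIdeal R ^ t) hsurj

open TensorProduct in
/-- If maps to `T ⊗ S` extend for every simple module `S`, then they extend for `T ⊗ N` for every
module `N` of finite length. -/
theorem ExtendsFrom.of_isFiniteLength {R T P : Type*} [CommRing R] [CommRing T] [Algebra R T]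
    [Module.Flat R T] [AddCommGroup P] [Module T P] [Module.Projective T P] {K : Submodule T P}
    (hS : ∀ I : Ideal R, I.IsMaximal → ExtendsFrom K (T ⊗[R] (R ⧸ I)))
    {N : Type*} [AddCommGroup N] [Module R N] (hN : IsFiniteLength R N) :
    ExtendsFrom K (T ⊗[R] N) := by
  induction hN with
  | of_subsingleton =>
    intro γ
    refine ⟨0, ?_⟩
    ext x
    exact Subsingleton.elim _ _
  | @of_simple_quotient M _ _ N hsimple hN ih =>
    obtain ⟨I, hI, ⟨e⟩⟩ := isSimpleModule_iff_quot_maximal.1 hsimple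
    refine ih.of_exact ((hS I hI).of_equiv (e.symm.baseChange R T _ _))
      (f := N.subtype.baseChange T) (g := N.mkQ.baseChange T) ?_ ?_ ?_
    · exact Module.Flat.lTensor_preserves_injective_linearMap _ N.injective_subtype
    · exact lTensor_exact T (LinearMap.exact_subtype_mkQ N) N.mkQ_surjective
    · exact LinearMap.lTensor_surjective T N.mkQ_surjective

end FiniteLength

section DualBases

open IsLocalRing

/-- A nonzero linear form on a finite field extension gives dual bases; this is the version of
that statement for residue fields of local rings, with the bases lifted to the rings. -/
theorem IsLocalRing.exists_dual_bases (A A' : Type*) [CommRing A] [CommRing A'] [Algebra A A']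
    [IsLocalRing A] [IsLocalRing A'] [IsLocalHom (algebraMap A A')] [Module.Finite A A'] :
    ∃ (n : ℕ) (e f : Fin n → A') (τ : A' →ₗ[A] ResidueField A),
      (∀ a ∈ maximalIdeal A', τ a = 0) ∧
      (∀ a, ∃ c : Fin n → A, a - ∑ i, c i • e i ∈ maximalIdeal A') ∧
      (∀ a, ∃ c : Fin n → A, a - ∑ i, c i • f i ∈ maximalIdeal A') ∧
      ∀ i j, τ (e i * f j) = if i = j then 1 else 0 := by
  classical
  let k := ResidueField A
  let k' := ResidueField A'
  obtain ⟨τ₀, hτ₀⟩ := (Algebra.linearMap k k').exists_leftInverse_of_injective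
    (LinearMap.ker_eq_bot.2 (algebraMap k k').injective)
  have hτ₁ : τ₀ 1 = 1 := by simpa using LinearMap.congr_fun hτ₀ 1
  let β : LinearMap.BilinForm k k' := (LinearMap.mul k k').compr₂ τ₀
  have hβ : β.Nondegenerate := by
    have h : ∀ x : k', (∀ y, τ₀ (x * y) = 0) → x = 0 := fun x hx => by
      by_contra h0
      have := hx x⁻¹
      rw [mul_inv_cancel₀ h0, hτ₁] at this
      exact one_ne_zero this
    exact ⟨fun x hx => h x hx, fun x hx => h x fun y => by rw [mul_comm]; exact hx y⟩
  have hsymm : β.IsSymm := ⟨fun x y => by simp [β, mul_comm]⟩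
  let b := Module.finBasis k k'
  let d := β.dualBasis hβ b
  have hd : ∀ i j, τ₀ (b i * d j) = if i = j then 1 else 0 := fun i j =>
    LinearMap.BilinForm.apply_dualBasis_right hβ hsymm b i j
  choose e he using fun i => residue_surjective (b i)
  choose f hf using fun i => residue_surjective (d i)
  have hspan : ∀ (v : Module.Basis (Fin (Module.finrank k k')) k k')
      (u : Fin (Module.finrank k k') → A'), (∀ i, residue A' (u i) = v i) →
      ∀ a, ∃ c : Fin (Module.finrank k k') → A, a - ∑ i, c i • u i ∈ maximalIdeal A' := by
    intro v u hu a
    choose c hc using fun i => residue_surjective (v.repr (residue A' a) i)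
    refine ⟨c, ?_⟩
    rw [← residue_eq_zero_iff, map_sub, map_sum, sub_eq_zero, ← v.sum_repr (residue A' a)]
    refine Finset.sum_congr rfl fun i _ => ?_
    rw [← hc, Algebra.smul_def (c i), map_mul, hu, Algebra.smul_def]
    rfl
  refine ⟨_, e, f, (τ₀.restrictScalars A) ∘ₗ (IsScalarTower.toAlgHom A A' k').toLinearMap,
    fun a ha => ?_, hspan b e he, hspan d f hf, fun i j => ?_⟩
  · have : algebraMap A' k' a = 0 := (residue_eq_zero_iff a).2 ha
    simp [this]
  · rw [← hd i j, ← he, ← hf, ← map_mul]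
    rfl

end DualBases

section TraceForm

variable {A A' B T : Type*} [CommRing A] [CommRing A'] [CommRing B] [CommRing T]
  [Algebra A A'] [Algebra A B] [Algebra A T] [Algebra A' T] [Algebra B T]
  [IsScalarTower A A' T] [IsScalarTower A B T]

/-- `e` and `f` are dual bases of `A' / I` with respect to the form `τ` with values in `B / J`. -/
structure IsDualBases (I : Ideal A') (J : Ideal B) {n : ℕ} (e f : Fin n → A')
    (τ : A' →ₗ[A] B ⧸ J) : Prop where
  apply_eq_zero : ∀ a ∈ I, τ a = 0
  exists_left : ∀ a, ∃ c : Fin n → A, a - ∑ i, c i • e i ∈ I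
  exists_right : ∀ a, ∃ c : Fin n → A, a - ∑ i, c i • f i ∈ I
  apply_mul : ∀ i j, τ (e i * f j) = if i = j then 1 else 0

namespace IsDualBases

variable {I : Ideal A'} {J : Ideal B} {n : ℕ} {e f : Fin n → A'} {τ : A' →ₗ[A] B ⧸ J}

theorem lift_eq_zero (h : IsDualBases I J e f τ)
    (hT : IsBaseChange B (IsScalarTower.toAlgHom A A' T).toLinearMap) {t : T}
    (ht : t ∈ I.map (algebraMap A' T)) : hT.lift τ t = 0 := by
  have key : ∀ a ∈ I, ∀ s : T, hT.lift τ (s * algebraMap A' T a) = 0 := by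
    intro a ha s
    refine hT.inductionOn s _ (by simp) (fun m => ?_) (fun b s hs => ?_) fun s s' hs hs' => ?_
    · have : (IsScalarTower.toAlgHom A A' T).toLinearMap m * algebraMap A' T a =
          (IsScalarTower.toAlgHom A A' T).toLinearMap (m * a) := by simp
      rw [this, hT.lift_eq]
      exact h.apply_eq_zero _ (I.mul_mem_left _ ha)
    · rw [smul_mul_assoc, map_smul, hs, smul_zero]
    · rw [add_mul, map_add, hs, hs', add_zero]
  refine Submodule.span_induction (p := fun t _ => ∀ s : T, hT.lift τ (s * t) = 0) ?_ ?_ ?_ ?_ ht 1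
    |> fun h => by simpa using h
  · rintro _ ⟨a, ha, rfl⟩
    exact key a ha
  · simp
  · intro x y _ _ hx hy s
    rw [mul_add, map_add, hx, hy, add_zero]
  · intro r x _ hx s
    rw [smul_eq_mul, ← mul_assoc, hx]

theorem exists_sub_mem (h : IsDualBases I J e f τ)
    (hT : IsBaseChange B (IsScalarTower.toAlgHom A A' T).toLinearMap) (t : T) :
    ∃ b : Fin n → B, t - ∑ i, b i • algebraMap A' T (f i) ∈ I.map (algebraMap A' T) := by
  refine hT.inductionOn t _ ⟨0, by simp⟩ (fun m => ?_) ?_ ?_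
  · obtain ⟨c, hc⟩ := h.exists_right m
    refine ⟨fun i => algebraMap A B (c i), ?_⟩
    convert Ideal.mem_map_of_mem (algebraMap A' T) hc using 1
    simp only [map_sub, map_sum, algebraMap_smul, Algebra.smul_def (c _), map_mul,
      ← IsScalarTower.algebraMap_apply]
    rfl
  · rintro b t ⟨c, hc⟩
    refine ⟨fun i => b * c i, ?_⟩
    convert Ideal.mul_mem_left _ (algebraMap B T b) hc using 1
    simp [Algebra.smul_def, mul_sub, Finset.mul_sum, mul_assoc]
  · rintro t t' ⟨c, hc⟩ ⟨c', hc'⟩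
    refine ⟨c + c', ?_⟩
    convert add_mem hc hc' using 1
    simp only [Pi.add_apply, add_smul, Finset.sum_add_distrib]
    abel

theorem mem_map_of_forall (h : IsDualBases I J e f τ)
    (hT : IsBaseChange B (IsScalarTower.toAlgHom A A' T).toLinearMap)
    (hJ : J.map (algebraMap B T) ≤ I.map (algebraMap A' T)) {t : T}
    (ht : ∀ s, hT.lift τ (s * t) = 0) : t ∈ I.map (algebraMap A' T) := by
  obtain ⟨b, hb⟩ := h.exists_sub_mem hT t
  have hbJ : ∀ i, b i ∈ J := by
    intro i
    have h1 : hT.lift τ (algebraMap A' T (e i) * ∑ j, b j • algebraMap A' T (f j)) = 0 := by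
      have := h.lift_eq_zero hT (Ideal.mul_mem_left _ (algebraMap A' T (e i)) hb)
      rwa [mul_sub, map_sub, ht, zero_sub, neg_eq_zero] at this
    have h2 : ∀ j, hT.lift τ (algebraMap A' T (e i) * algebraMap A' T (f j)) =
        if i = j then 1 else 0 := fun j => by
      rw [← h.apply_mul, ← hT.lift_eq, ← map_mul]
      rfl
    simp only [Finset.mul_sum, mul_smul_comm, map_sum, map_smul, h2] at h1
    simpa [Algebra.smul_def, Ideal.Quotient.eq_zero_iff_mem] using h1
  refine (Submodule.sub_mem_iff_left _ ?_).1 hb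
  refine Submodule.sum_mem _ fun i _ => ?_
  rw [Algebra.smul_def]
  exact Ideal.mul_mem_right _ _ (hJ (Ideal.mem_map_of_mem _ (hbJ i)))

variable {P : Type*} [AddCommGroup P] [Module T P] [Module B P] [IsScalarTower B T P]

theorem exists_forall_lift_eq (h : IsDualBases I J e f τ)
    (hT : IsBaseChange B (IsScalarTower.toAlgHom A A' T).toLinearMap) (g : P →ₗ[B] B ⧸ J)
    (hg : ∀ a ∈ I, ∀ x, g (algebraMap A' T a • x) = 0) (x : P) :
    ∃ t : T, ∀ s : T, hT.lift τ (s * t) = g (s • x) := by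
  choose b hb using fun i => Ideal.Quotient.mk_surjective (g (algebraMap A' T (e i) • x))
  refine ⟨∑ i, b i • algebraMap A' T (f i), fun s => ?_⟩
  refine hT.inductionOn s _ (by simp) (fun a => ?_) (fun r s hs => ?_) fun s s' hs hs' => ?_
  · obtain ⟨c, hc⟩ := h.exists_left a
    have h1 : ∀ j, τ (a * f j) = algebraMap A (B ⧸ J) (c j) := by
      intro j
      have := h.apply_eq_zero _ (I.mul_mem_right (f j) hc)
      rw [sub_mul, map_sub, sub_eq_zero] at this
      rw [this]
      simp only [Finset.sum_mul, smul_mul_assoc, map_sum, map_smul, h.apply_mul]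
      simp [Algebra.smul_def]
    have h2 : g (algebraMap A' T a • x) =
        ∑ i, algebraMap A B (c i) • g (algebraMap A' T (e i) • x) := by
      have := hg _ hc x
      rw [map_sub, sub_smul, map_sub, sub_eq_zero] at this
      rw [this, map_sum, Finset.sum_smul, map_sum]
      refine Finset.sum_congr rfl fun i _ => ?_
      rw [← map_smul, ← smul_assoc, Algebra.smul_def (c i), map_mul,
        ← IsScalarTower.algebraMap_apply, Algebra.smul_def (algebraMap A B (c i)),
        ← IsScalarTower.algebraMap_apply]
    have h3 : ∀ j, hT.lift τ (algebraMap A' T a * algebraMap A' T (f j)) =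
        algebraMap A (B ⧸ J) (c j) := fun j => by
      rw [← h1, ← hT.lift_eq, ← map_mul]
      rfl
    change hT.lift τ (algebraMap A' T a * _) = g (algebraMap A' T a • x)
    rw [h2]
    simp only [Finset.mul_sum, mul_smul_comm, map_sum, map_smul, h3, ← hb]
    refine Finset.sum_congr rfl fun i _ => ?_
    simp only [Algebra.smul_def, Ideal.Quotient.algebraMap_eq, ← map_mul]
    rw [IsScalarTower.algebraMap_apply A B (B ⧸ J), Ideal.Quotient.algebraMap_eq, ← map_mul,
      mul_comm]
  · rw [smul_mul_assoc, map_smul, hs, smul_assoc, g.map_smul]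
  · rw [add_mul, map_add, hs, hs', add_smul, map_add]

/-- A `B`-linear form on `P` killed by `I` comes from a `T`-linear map `P → T / I T`. -/
theorem exists_linearMap (h : IsDualBases I J e f τ)
    (hT : IsBaseChange B (IsScalarTower.toAlgHom A A' T).toLinearMap)
    (hJ : J.map (algebraMap B T) ≤ I.map (algebraMap A' T)) (g : P →ₗ[B] B ⧸ J)
    (hg : ∀ a ∈ I, ∀ x, g (algebraMap A' T a • x) = 0) :
    ∃ G : P →ₗ[T] T ⧸ I.map (algebraMap A' T),
      ∀ x t, Ideal.Quotient.mk _ t = G x → ∀ s, hT.lift τ (s * t) = g (s • x) := by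
  choose t ht using h.exists_forall_lift_eq hT g hg
  refine ⟨⟨⟨fun x => Ideal.Quotient.mk _ (t x), fun x y => ?_⟩, fun s x => ?_⟩, ?_⟩
  · rw [← map_add, Ideal.Quotient.eq]
    refine h.mem_map_of_forall hT hJ fun s => ?_
    rw [mul_sub, mul_add, map_sub, map_add, ht, ht, ht, smul_add, map_add, sub_self]
  · change _ = s • Ideal.Quotient.mk _ (t x)
    rw [Algebra.smul_def, Ideal.Quotient.algebraMap_eq, ← map_mul, Ideal.Quotient.eq]
    refine h.mem_map_of_forall hT hJ fun r => ?_
    rw [mul_sub, map_sub, ← mul_assoc, ht, ht, mul_smul, sub_self]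
  · intro x t' ht' s
    have := h.lift_eq_zero hT (Ideal.mul_mem_left _ s (Ideal.Quotient.eq.1 ht'))
    rw [mul_sub, map_sub, sub_eq_zero] at this
    rw [this, ht]

theorem extendsFrom_quotient (h : IsDualBases I J e f τ)
    (hT : IsBaseChange B (IsScalarTower.toAlgHom A A' T).toLinearMap)
    (hJ : J.map (algebraMap B T) ≤ I.map (algebraMap A' T)) {K : Submodule T P}
    (hK : ∀ g₀ : K →ₗ[B] B ⧸ J, (∀ a ∈ I, ∀ x, g₀ (algebraMap A' T a • x) = 0) →
      ∃ g : P →ₗ[B] B ⧸ J, (∀ a ∈ I, ∀ x, g (algebraMap A' T a • x) = 0) ∧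
        ∀ x : K, g x = g₀ x) :
    ExtendsFrom K (T ⧸ I.map (algebraMap A' T)) := by
  intro γ
  let τX : (T ⧸ I.map (algebraMap A' T)) →ₗ[B] B ⧸ J :=
    ((I.map (algebraMap A' T)).restrictScalars B).liftQ (hT.lift τ) fun t ht =>
      h.lift_eq_zero hT ht
  have hτX : ∀ t : T, τX (Ideal.Quotient.mk _ t) = hT.lift τ t := fun t => rfl
  obtain ⟨g, hg, hgK⟩ := hK (τX ∘ₗ γ.restrictScalars B) (by
    intro a ha x
    obtain ⟨t, ht⟩ := Ideal.Quotient.mk_surjective (γ x)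
    have : γ (algebraMap A' T a • x) = 0 := by
      rw [map_smul, ← ht, Algebra.smul_def, Ideal.Quotient.algebraMap_eq, ← map_mul,
        Ideal.Quotient.eq_zero_iff_mem]
      exact Ideal.mul_mem_right _ _ (Ideal.mem_map_of_mem _ ha)
    simp [this])
  obtain ⟨G, hG⟩ := h.exists_linearMap hT hJ g hg
  refine ⟨G, LinearMap.ext fun x => ?_⟩
  obtain ⟨t, ht⟩ := Ideal.Quotient.mk_surjective (G x)
  obtain ⟨t', ht'⟩ := Ideal.Quotient.mk_surjective (γ x)
  rw [LinearMap.comp_apply, Submodule.subtype_apply, ← ht, ← ht', Ideal.Quotient.eq]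
  refine h.mem_map_of_forall hT hJ fun s => ?_
  rw [mul_sub, map_sub, hG x t ht, ← hτX (s * t'), sub_eq_zero]
  have h1 := hgK (s • x)
  rw [Submodule.coe_smul] at h1
  rw [h1]
  change τX (γ (s • x)) = _
  rw [map_smul, ← ht', Algebra.smul_def, Ideal.Quotient.algebraMap_eq,
    ← map_mul (Ideal.Quotient.mk _)]

end IsDualBases

end TraceForm

/-- A surjection onto a projective `B / J`-module from a `B`-module killed by `J` splits. -/
theorem Module.Projective.exists_rightInverse_of_quotient {B Q M : Type*} [CommRing B]
    (J : Ideal B) [AddCommGroup Q] [Module B Q] [AddCommGroup M] [Module B M] [Module (B ⧸ J) M]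
    [IsScalarTower B (B ⧸ J) M] [Module.Projective (B ⧸ J) M]
    (hQ : ∀ a ∈ J, ∀ x : Q, a • x = 0) (f : Q →ₗ[B] M) (hf : Function.Surjective f) :
    ∃ s : M →ₗ[B] Q, f ∘ₗ s = LinearMap.id := by
  have hQ' : Module.IsTorsionBySet B Q J := fun x a => hQ a a.2 x
  let := hQ'.module
  have : IsScalarTower B (B ⧸ J) Q := hQ'.isScalarTower
  obtain ⟨s, hs⟩ := Module.projective_lifting_property
    (f.extendScalarsOfSurjective (Ideal.Quotient.mk_surjective (I := J)))
    (LinearMap.id (R := B ⧸ J) (M := M)) hf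
  refine ⟨s.restrictScalars B, LinearMap.ext fun x => LinearMap.congr_fun hs x⟩

theorem exists_extension_of_projective_quotient {A' B T P M M' : Type*} [CommRing A'] [CommRing B]
    [CommRing T] [Algebra A' T] [Algebra B T] [AddCommGroup P] [Module T P] [Module B P]
    [Module A' P] [IsScalarTower B T P] [IsScalarTower A' T P]
    [AddCommGroup M] [Module T M] [Module B M] [Module A' M] [IsScalarTower B T M]
    [IsScalarTower A' T M] [Module.Flat A' M] {I : Ideal A'} {J : Ideal B}
    (hJ : J.map (algebraMap B T) ≤ I.map (algebraMap A' T))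
    [AddCommGroup M'] [Module B M'] [Module (B ⧸ J) M'] [IsScalarTower B (B ⧸ J) M']
    [Module.Projective (B ⧸ J) M'] (π : M →ₗ[B] M') (hπ : Function.Surjective π)
    (hπI : ∀ x, π x = 0 ↔ x ∈ I • (⊤ : Submodule A' M))
    (φ : P →ₗ[T] M) (hφ : Function.Surjective φ) (g₀ : LinearMap.ker φ →ₗ[B] B ⧸ J)
    (hg₀ : ∀ a ∈ I, ∀ x, g₀ (algebraMap A' T a • x) = 0) :
    ∃ g : P →ₗ[B] B ⧸ J, (∀ a ∈ I, ∀ x, g (algebraMap A' T a • x) = 0) ∧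
        ∀ x : LinearMap.ker φ, g x = g₀ x := by
  let N : Submodule T P := I.map (algebraMap A' T) • ⊤
  have hM (x : M) : π x = 0 ↔ x ∈ I.map (algebraMap A' T) • (⊤ : Submodule T M) := by
    rw [hπI, ← Submodule.restrictScalars_mem A' (I.map (algebraMap A' T) • (⊤ : Submodule T M)),
      Ideal.smul_restrictScalars, Submodule.restrictScalars_top]
  have hmap : N.map φ = I.map (algebraMap A' T) • ⊤ := by
    rw [Submodule.map_smul'', Submodule.map_top, LinearMap.range_eq_top.2 hφ]
  let f : (P ⧸ N) →ₗ[B] M' := (N.restrictScalars B).liftQ (π ∘ₗ φ.restrictScalars B) fun x hx =>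
    (hM _).2 (hmap ▸ Submodule.mem_map_of_mem hx)
  have hf : Function.Surjective f := by
    intro y
    obtain ⟨m, rfl⟩ := hπ y
    obtain ⟨x, rfl⟩ := hφ m
    exact ⟨N.mkQ x, rfl⟩
  obtain ⟨s, hs⟩ := Module.Projective.exists_rightInverse_of_quotient J (Q := P ⧸ N) (by
    intro a ha x
    obtain ⟨x, rfl⟩ := N.mkQ_surjective x
    rw [← algebraMap_smul T, ← map_smul, Submodule.mkQ_apply, Submodule.Quotient.mk_eq_zero]
    exact Submodule.smul_mem_smul (hJ (Ideal.mem_map_of_mem _ ha)) trivial) f hf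
  let κ : LinearMap.ker φ →ₗ[B] P ⧸ N := (N.mkQ ∘ₗ (LinearMap.ker φ).subtype).restrictScalars B
  have hκ : LinearMap.ker κ ≤ LinearMap.ker g₀ := by
    intro x hx
    have hxN : (x : P) ∈ I • (⊤ : Submodule A' P) := by
      rw [← Submodule.restrictScalars_top A' T P, ← Ideal.smul_restrictScalars]
      exact (Submodule.Quotient.mk_eq_zero N).1 hx
    have h1 := Submodule.mem_smul_ker_of_flat (φ.restrictScalars A') hφ (x := (x : P)) x.2 hxN
    have h2 : ∀ y (hy : y ∈ I • LinearMap.ker (φ.restrictScalars A')),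
        ∃ h : y ∈ LinearMap.ker φ, g₀ ⟨y, h⟩ = 0 := by
      intro y hy
      induction hy using Submodule.smul_induction_on' with
      | smul a ha y hy =>
        refine ⟨(LinearMap.ker (φ.restrictScalars A')).smul_mem a hy, ?_⟩
        rw [← hg₀ a ha ⟨y, hy⟩]
        congr 1
        exact Subtype.ext (algebraMap_smul T a y).symm
      | add y _ z _ hy hz =>
        obtain ⟨hy, hy'⟩ := hy
        obtain ⟨hz, hz'⟩ := hz
        refine ⟨add_mem hy hz, ?_⟩
        rw [← add_zero 0]
        nth_rewrite 1 [← hy']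
        rw [← hz', ← map_add]
        rfl
    exact (h2 x h1).2
  have hr : ∀ y, (LinearMap.id - s ∘ₗ f : (P ⧸ N) →ₗ[B] P ⧸ N) y ∈ LinearMap.range κ := by
    intro y
    obtain ⟨x, hx⟩ := N.mkQ_surjective ((LinearMap.id - s ∘ₗ f : (P ⧸ N) →ₗ[B] P ⧸ N) y)
    have h1 : π (φ x) = 0 := by
      change f (N.mkQ x) = 0
      rw [hx]
      simpa [sub_eq_zero] using (LinearMap.congr_fun hs (f y)).symm
    rw [hM, ← hmap] at h1
    obtain ⟨z, hz, hzx⟩ := h1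
    refine ⟨⟨x - z, by simp [hzx]⟩, ?_⟩
    rw [← hx]
    change N.mkQ (x - z) = _
    rw [map_sub, (Submodule.mkQ_apply N z).trans ((Submodule.Quotient.mk_eq_zero N).2 hz), sub_zero]
  let g : P →ₗ[B] B ⧸ J := (LinearMap.ker κ).liftQ g₀ hκ ∘ₗ
    κ.quotKerEquivRange.symm.toLinearMap ∘ₗ
    (LinearMap.id - s ∘ₗ f : (P ⧸ N) →ₗ[B] P ⧸ N).codRestrict _ hr ∘ₗ N.mkQ.restrictScalars B
  refine ⟨g, fun a ha x => ?_, fun x => ?_⟩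
  · have : N.mkQ.restrictScalars B (algebraMap A' T a • x) = 0 :=
      (Submodule.Quotient.mk_eq_zero N).2
        (Submodule.smul_mem_smul (Ideal.mem_map_of_mem _ ha) trivial)
    simp only [g, LinearMap.comp_apply, this, map_zero]
  · have h1 : f (N.mkQ x) = 0 := by
      change π (φ x) = 0
      rw [LinearMap.mem_ker.1 x.2, map_zero]
    have h2 : (LinearMap.id - s ∘ₗ f : (P ⧸ N) →ₗ[B] P ⧸ N).codRestrict _ hr (N.mkQ x) =
        ⟨κ x, LinearMap.mem_range_self _ _⟩ := by
      ext
      simp only [LinearMap.codRestrict_apply, LinearMap.sub_apply, LinearMap.comp_apply, h1,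
        map_zero, sub_zero]
      rfl
    change (LinearMap.ker κ).liftQ g₀ hκ (κ.quotKerEquivRange.symm
      ((LinearMap.id - s ∘ₗ f : (P ⧸ N) →ₗ[B] P ⧸ N).codRestrict _ hr (N.mkQ x))) = _
    rw [h2, LinearMap.quotKerEquivRange_symm_apply_image]
    rfl

open IsLocalRing TensorProduct

theorem exists_lift_of_extendsFrom {A' T M : Type*} [CommRing A'] [IsLocalRing A']
    [IsNoetherianRing A'] [CommRing T] [IsNoetherianRing T] [Algebra A' T] [Module.Flat A' T]
    [AddCommGroup M] [Module T M] {n : ℕ} (φ : (Fin n → T) →ₗ[T] M) (hφ : Function.Surjective φ)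
    (hK : ExtendsFrom (LinearMap.ker φ) (T ⧸ (maximalIdeal A').map (algebraMap A' T)))
    (G : M →ₗ[T] T ⧸ (maximalIdeal A').map (algebraMap A' T)) :
    ∃ h : M →ₗ[T] T, ∀ x, Ideal.Quotient.mk _ (h x) = G x := by
  let I := maximalIdeal A'
  obtain ⟨t, ht⟩ := exists_pow_forall_exists_congr (LinearMap.ker φ) (I.map (algebraMap A' T))
  let q : (A' ⧸ I ^ (t + 1)) →ₗ[A'] A' ⧸ I := Submodule.factor (Ideal.pow_le_self t.succ_ne_zero)
  have hq : Function.Surjective q := Submodule.factor_surjective _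
  have hN : IsFiniteLength A' (LinearMap.ker q) := by
    have h1 := IsLocalRing.isFiniteLength_quotient_maximalIdeal_pow A' (t + 1)
    rw [isFiniteLength_iff_isNoetherian_isArtinian] at h1 ⊢
    obtain ⟨_, _⟩ := h1
    exact ⟨inferInstance, inferInstance⟩
  have hgood : ExtendsFrom (LinearMap.ker φ) (T ⊗[A'] LinearMap.ker q) := by
    refine ExtendsFrom.of_isFiniteLength (fun I hI => ?_) hN
    rw [IsLocalRing.eq_maximalIdeal hI]
    exact hK.of_equiv
      (Algebra.TensorProduct.quotIdealMapEquivTensorQuot T (maximalIdeal A')).toLinearEquiv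
  let e₁ := (Algebra.TensorProduct.quotIdealMapEquivTensorQuot T I).toLinearEquiv
  let e₂ := (Algebra.TensorProduct.quotIdealMapEquivTensorQuot T (I ^ (t + 1))).toLinearEquiv
  obtain ⟨H, hHK, hH⟩ := hgood.exists_lift
    (f := AlgebraTensorModule.lTensor T T (LinearMap.ker q).subtype)
    (g := AlgebraTensorModule.lTensor T T q)
    (Module.Flat.lTensor_preserves_injective_linearMap _ Subtype.val_injective)
    (lTensor_exact T (LinearMap.exact_subtype_ker_map q) hq)
    (LinearMap.lTensor_surjective T hq) (e₁.toLinearMap ∘ₗ G ∘ₗ φ) (by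
      ext x
      simp)
  obtain ⟨g, hg⟩ := Module.projective_lifting_property
    (((I ^ (t + 1)).map (algebraMap A' T)).mkQ) (e₂.symm.toLinearMap ∘ₗ H)
    (Submodule.mkQ_surjective _)
  have hg' : ∀ x, H x = g x ⊗ₜ 1 := fun x => by
    have := congrArg e₂ (LinearMap.congr_fun hg x)
    simp only [LinearMap.comp_apply, LinearEquiv.coe_coe, LinearEquiv.apply_symm_apply] at this
    rw [← this]
    exact Algebra.TensorProduct.quotIdealMapEquivTensorQuot_mk _ _ _
  have hgG : ∀ x, Ideal.Quotient.mk _ (g x) = G (φ x) := fun x => by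
    apply e₁.injective
    have := LinearMap.congr_fun hH x
    simp only [LinearMap.comp_apply, hg', LinearEquiv.coe_coe] at this
    rw [← this]
    exact Algebra.TensorProduct.quotIdealMapEquivTensorQuot_mk _ _ _
  obtain ⟨h, hhK, hh⟩ := ht g fun x hx => by
    rw [← Ideal.map_pow]
    refine Ideal.map_mono (Ideal.pow_le_pow_right t.le_succ) ?_
    rw [← Ideal.Quotient.eq_zero_iff_mem]
    apply e₂.injective
    rw [map_zero]
    exact (Algebra.TensorProduct.quotIdealMapEquivTensorQuot_mk _ _ _).trans
      ((hg' x).symm.trans (LinearMap.congr_fun hHK ⟨x, hx⟩))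
  refine ⟨(LinearMap.ker φ).liftQ h hhK ∘ₗ (φ.quotKerEquivOfSurjective hφ).symm.toLinearMap,
    fun x => ?_⟩
  obtain ⟨x, rfl⟩ := hφ x
  rw [← hgG, LinearMap.comp_apply, LinearEquiv.coe_coe]
  have : (φ.quotKerEquivOfSurjective hφ).symm (φ x) = (LinearMap.ker φ).mkQ x := by
    rw [LinearEquiv.symm_apply_eq]
    rfl
  rw [this, eq_comm, Ideal.Quotient.eq]
  exact hh x

section

variable {A A' B T : Type*} [CommRing A] [CommRing A'] [CommRing B] [CommRing T]
  [Algebra A A'] [Algebra A B] [Algebra A T] [Algebra A' T] [Algebra B T]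
  [IsScalarTower A A' T] [IsScalarTower A B T] [IsLocalRing A] [IsLocalRing A'] [IsLocalRing B]
  [IsLocalHom (algebraMap A B)]

theorem exists_isUnit_lift_mul
    (hT : IsBaseChange B (IsScalarTower.toAlgHom A A' T).toLinearMap) (φ : A' →ₗ[A] A)
    (hφ : φ 1 = 1) (ω : T →ₗ[B] ResidueField B)
    (hω : ∀ a ∈ maximalIdeal A', ω (algebraMap A' T a) = 0) (c : T) (hc : ω c ≠ 0) :
    ∃ a, IsUnit (hT.lift (Algebra.linearMap A B ∘ₗ φ) (algebraMap A' T a * c)) := by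
  let k := ResidueField A
  let l := ResidueField B
  let β := Module.Free.chooseBasis k l
  choose u hu using fun i => residue_surjective (R := B) (β i)
  let N : Submodule B T := maximalIdeal B • ⊤
  have hNω : ∀ t ∈ N, ω t = 0 := fun t ht => by
    induction ht using Submodule.smul_induction_on' with
    | smul b hb t _ =>
      rw [map_smul, Algebra.smul_def, ResidueField.algebraMap_eq, (residue_eq_zero_iff b).2 hb,
        zero_mul]
    | add t _ t' _ h h' => rw [map_add, h, h', add_zero]
  have hNB : ∀ F : T →ₗ[B] B, ∀ t ∈ N, residue B (F t) = 0 := fun F t ht => by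
    induction ht using Submodule.smul_induction_on' with
    | smul b hb t _ =>
      rw [map_smul, smul_eq_mul, map_mul, (residue_eq_zero_iff b).2 hb, zero_mul]
    | add t _ t' _ h h' => rw [map_add, map_add, h, h', add_zero]
  have hdecomp : ∀ c : T, ∀ r : B, ∃ y : Module.Free.ChooseBasisIndex k l →₀ A',
      r • c - y.sum (fun i a => u i • algebraMap A' T a) ∈ N := by
    intro c
    refine hT.inductionOn c _ (fun r => ⟨0, by simp⟩) (fun m r => ?_) (fun s c hc r => ?_)
      fun c c' hc hc' r => ?_
    · choose v hv using fun i => residue_surjective (R := A) (β.repr (residue B r) i)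
      refine ⟨∑ i ∈ (β.repr (residue B r)).support, Finsupp.single i (v i • m), ?_⟩
      rw [← Finsupp.sum_finsetSum_index (by simp) (by simp [smul_add])]
      have h1 : residue B (r - ∑ i ∈ (β.repr (residue B r)).support,
          algebraMap A B (v i) * u i) = 0 := by
        rw [map_sub, map_sum, sub_eq_zero]
        conv_lhs => rw [← β.linearCombination_repr (residue B r)]
        rw [Finsupp.linearCombination_apply, Finsupp.sum]
        refine Finset.sum_congr rfl fun i _ => ?_
        rw [map_mul, hu, ← hv, Algebra.smul_def]
        rfl
      convert Submodule.smul_mem_smul ((residue_eq_zero_iff _).1 h1)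
        (Submodule.mem_top (x := algebraMap A' T m)) using 1
      rw [sub_smul, Finset.sum_smul]
      congr 1
      refine Finset.sum_congr rfl fun i _ => ?_
      rw [Finsupp.sum_single_index (by simp), mul_comm, mul_smul, algebraMap_smul,
        Algebra.smul_def (v i) m, map_mul, ← IsScalarTower.algebraMap_apply, ← Algebra.smul_def]
    · rw [← mul_smul]
      exact hc _
    · obtain ⟨y, hy⟩ := hc r
      obtain ⟨y', hy'⟩ := hc' r
      refine ⟨y + y', ?_⟩
      classical
      rw [Finsupp.sum_add_index' (by simp) (by simp [smul_add])]
      convert add_mem hy hy' using 1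
      rw [smul_add]
      abel
  obtain ⟨y, hy⟩ := hdecomp c 1
  rw [one_smul] at hy
  obtain ⟨i, hi⟩ : ∃ i, IsUnit (y i) := by
    by_contra! H
    apply hc
    have := hNω _ hy
    rw [map_sub, sub_eq_zero] at this
    rw [this, Finsupp.sum, map_sum]
    refine Finset.sum_eq_zero fun i _ => ?_
    rw [map_smul, hω _ ((mem_maximalIdeal _).2 (H i)), smul_zero]
  obtain ⟨a, ha⟩ := hi.exists_right_inv
  refine ⟨a, ?_⟩
  let F : T →ₗ[B] B :=
    hT.lift (Algebra.linearMap A B ∘ₗ φ) ∘ₗ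
      (LinearMap.mulLeft T (algebraMap A' T a)).restrictScalars B
  have hF : ∀ x, F (algebraMap A' T x) = algebraMap A B (φ (a * x)) := fun x => by
    have := hT.lift_eq (Algebra.linearMap A B ∘ₗ φ) (a * x)
    simpa [F] using this
  have h1 := hNB F _ hy
  rw [map_sub, map_sub, sub_eq_zero] at h1
  have h2 : residue B (F c) = y.sum fun i x => residue A (φ (a * x)) • β i := by
    rw [h1, Finsupp.sum, Finsupp.sum, map_sum, map_sum]
    refine Finset.sum_congr rfl fun i _ => ?_
    rw [map_smul, hF, smul_eq_mul, map_mul, hu, mul_comm, Algebra.smul_def]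
    rfl
  rw [← residue_ne_zero_iff_isUnit]
  change residue B (F c) ≠ 0
  intro h0
  rw [h0, eq_comm] at h2
  have h3 := linearIndependent_iff'.1 β.linearIndependent y.support
    (fun i => residue A (φ (a * y i))) h2 i (by
      rw [Finsupp.mem_support_iff]
      exact hi.ne_zero)
  rw [mul_comm, ha, hφ, map_one] at h3
  exact one_ne_zero h3

/-- The local core of the descent of Frobenius splittings: `T = B ⊗ A'`, where `A'` and `M` play
the role of `A` and `B` viewed as modules via the Frobenius. -/
theorem exists_linearMap_isUnit_apply [IsNoetherianRing A'] [IsNoetherianRing T]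
    [Module.Flat A' T] [Module.Finite A A'] [IsLocalHom (algebraMap A A')]
    (hT : IsBaseChange B (IsScalarTower.toAlgHom A A' T).toLinearMap)
    {J : Ideal B} (hJ : J = (maximalIdeal A).map (algebraMap A B))
    {M M' : Type*} [AddCommGroup M] [Module T M] [Module B M] [Module A' M] [IsScalarTower B T M]
    [IsScalarTower A' T M] [Module.Flat A' M] [Module.Finite T M]
    [AddCommGroup M'] [Module B M'] [Module (B ⧸ J) M'] [IsScalarTower B (B ⧸ J) M']
    [Module.Projective (B ⧸ J) M'] (π : M →ₗ[B] M') (hπ : Function.Surjective π)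
    (hπI : ∀ x, π x = 0 ↔ x ∈ maximalIdeal A' • (⊤ : Submodule A' M))
    (σ : M' →ₗ[B] B ⧸ J) (e : M) (he : σ (π e) = 1) (φ : A' →ₗ[A] A) (hφ : φ 1 = 1) :
    ∃ ψ : M →ₗ[B] B, IsUnit (ψ e) := by
  have hJB : J ≤ maximalIdeal B := by
    rw [hJ]
    exact IsLocalRing.map_maximalIdeal_le _
  have hJT : J.map (algebraMap B T) ≤ (maximalIdeal A').map (algebraMap A' T) := by
    rw [hJ, Ideal.map_map, ← IsScalarTower.algebraMap_eq, IsScalarTower.algebraMap_eq A A' T,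
      ← Ideal.map_map]
    exact Ideal.map_mono (IsLocalRing.map_maximalIdeal_le _)
  obtain ⟨n, u, v, τ, hτ, hu, hv, huv⟩ := IsLocalRing.exists_dual_bases A A'
  let ι : ResidueField A →ₗ[A] B ⧸ J :=
    Submodule.liftQ (maximalIdeal A) (Algebra.linearMap A (B ⧸ J)) fun a ha => by
      rw [LinearMap.mem_ker, Algebra.linearMap_apply, IsScalarTower.algebraMap_apply A B (B ⧸ J),
        Ideal.Quotient.algebraMap_eq, Ideal.Quotient.eq_zero_iff_mem, hJ]
      exact Ideal.mem_map_of_mem _ ha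
  have hι : ι 1 = 1 := map_one (algebraMap A (B ⧸ J))
  have hdual : IsDualBases (maximalIdeal A') J u v (ι ∘ₗ τ) :=
    ⟨fun a ha => by rw [LinearMap.comp_apply, hτ a ha, map_zero], hu, hv, fun i j => by
      rw [LinearMap.comp_apply, huv, apply_ite ι, hι, map_zero]⟩
  obtain ⟨l, f, hf⟩ := Module.Finite.exists_fin' T M
  have hK := hdual.extendsFrom_quotient hT hJT
    (exists_extension_of_projective_quotient hJT π hπ hπI f hf)
  have hσπ : ∀ a ∈ maximalIdeal A', ∀ x, (σ ∘ₗ π) (algebraMap A' T a • x) = 0 := fun a ha x => by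
    rw [LinearMap.comp_apply, (hπI _).2, map_zero]
    rw [algebraMap_smul]
    exact Submodule.smul_mem_smul ha trivial
  obtain ⟨G, hG⟩ := hdual.exists_linearMap hT hJT (σ ∘ₗ π) hσπ
  obtain ⟨h, hh⟩ := exists_lift_of_extendsFrom f hf hK G
  have h1 := hG e (h e) (hh e) 1
  rw [one_mul, one_smul, LinearMap.comp_apply, he] at h1
  let ρ : (B ⧸ J) →ₗ[B] ResidueField B := Submodule.factor hJB
  have hρ : ρ 1 = 1 := map_one (residue B)
  obtain ⟨a, ha⟩ := exists_isUnit_lift_mul hT φ hφ (ρ ∘ₗ hT.lift (ι ∘ₗ τ)) (fun a ha => by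
    rw [LinearMap.comp_apply, hdual.lift_eq_zero hT (Ideal.mem_map_of_mem _ ha), map_zero]) (h e)
    (by rw [LinearMap.comp_apply, h1, hρ]; exact one_ne_zero)
  exact ⟨hT.lift (Algebra.linearMap A B ∘ₗ φ) ∘ₗ
    (LinearMap.mulLeft T (algebraMap A' T a)).restrictScalars B ∘ₗ h.restrictScalars B, ha⟩

end

section RegularLocal

variable {R : Type*} [CommRing R]

theorem IsRegularLocalRing.exists_quotient_span_singleton [IsRegularLocalRing R] {d : ℕ}
    (hd : ringKrullDim R = (d + 1 : ℕ)) : ∃ x ∈ maximalIdeal R,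
      IsRegularLocalRing (R ⧸ Ideal.span {x}) ∧ ringKrullDim (R ⧸ Ideal.span {x}) = d := by
  classical
  obtain ⟨s, hs, hspan⟩ := Submodule.FG.exists_span_finset_card_eq_spanFinrank
    (IsNoetherian.noetherian (maximalIdeal R))
  have hcard : s.card = d + 1 := by
    have := spanFinrank_maximalIdeal (R := R)
    rw [hd, ← hs] at this
    exact_mod_cast this
  obtain ⟨x, hx⟩ : s.Nonempty := by
    rw [← Finset.card_pos]
    omega
  have hxm : x ∈ maximalIdeal R := hspan ▸ Submodule.subset_span hx
  have hne : Ideal.span {x} ≠ ⊤ := fun h =>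
    (maximalIdeal.isMaximal R).ne_top (top_le_iff.1 (h ▸ (Ideal.span_singleton_le_iff_mem _).2 hxm))
  have : Nontrivial (R ⧸ Ideal.span {x}) := Ideal.Quotient.nontrivial_iff.2 hne
  have hsurj := Ideal.Quotient.mk_surjective (I := Ideal.span {x})
  have := IsLocalRing.of_surjective' _ hsurj
  have hmax : maximalIdeal (R ⧸ Ideal.span {x}) =
      Ideal.span ((s.erase x).image (Ideal.Quotient.mk (Ideal.span {x})) : Set _) := by
    rw [← IsLocalRing.map_maximalIdeal_of_surjective _ hsurj, ← hspan,
      ← Ideal.span, Ideal.map_span]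
    refine le_antisymm (Ideal.span_le.2 ?_) (Ideal.span_mono ?_)
    · rintro _ ⟨y, hy, rfl⟩
      by_cases hyx : y = x
      · rw [hyx, Ideal.Quotient.eq_zero_iff_mem.2 (Ideal.mem_span_singleton_self x)]
        exact zero_mem _
      · exact Ideal.subset_span (Finset.mem_image_of_mem _ (Finset.mem_erase.2 ⟨hyx, hy⟩))
    · rw [Finset.coe_image]
      exact Set.image_mono (Finset.erase_subset _ _)
  have h1 : (maximalIdeal (R ⧸ Ideal.span {x})).spanFinrank ≤ d := by
    rw [hmax]
    refine (Submodule.spanFinrank_span_le_ncard_of_finite (Finset.finite_toSet _)).trans ?_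
    rw [Set.ncard_coe_finset]
    refine Finset.card_image_le.trans ?_
    rw [Finset.card_erase_of_mem hx, hcard]
    omega
  have h2 : (d : WithBot ℕ∞) ≤ ringKrullDim (R ⧸ Ideal.span {x}) := by
    have := ringKrullDim_le_ringKrullDim_quotient_add_card {x} (R := R) (by
      simpa [IsLocalRing.ringJacobson_eq_maximalIdeal] using hxm)
    rw [hd, Finset.coe_singleton, Finset.card_singleton, Nat.cast_add] at this
    exact ENat.WithBot.add_le_add_one_right_iff.1 this
  have h3 : ((maximalIdeal (R ⧸ Ideal.span {x})).spanFinrank : WithBot ℕ∞) ≤ d := by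
    exact_mod_cast h1
  have hreg := IsRegularLocalRing.of_spanFinrank_maximalIdeal_le _ (h3.trans h2)
  exact ⟨x, hxm, hreg, ((spanFinrank_maximalIdeal (R := R ⧸ Ideal.span {x})).symm.trans_le
    h3).antisymm h2⟩

theorem exists_isPrime_ringKrullDim_le [IsNoetherianRing R] [IsLocalRing R] :
    ∃ P : Ideal R, P.IsPrime ∧ ringKrullDim R ≤ ringKrullDim (R ⧸ P) := by
  let l := LTSeries.longestOf (PrimeSpectrum R)
  refine ⟨l.head.asIdeal, l.head.isPrime, ?_⟩
  rw [ringKrullDim_quotient, ringKrullDim, Order.krullDim_eq_length_of_finiteDimensionalOrder]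
  let l' : LTSeries (PrimeSpectrum.zeroLocus (R := R) l.head.asIdeal) :=
    ⟨l.length, fun i => ⟨l i, l.head_le i⟩, l.step⟩
  exact Order.LTSeries.length_le_krullDim l'

/-- A regular local ring is a domain. -/
theorem IsRegularLocalRing.isDomain [IsRegularLocalRing R] : IsDomain R := by
  obtain ⟨d, hd⟩ : ∃ d : ℕ, ringKrullDim R = d := ⟨_, (spanFinrank_maximalIdeal (R := R)).symm⟩
  induction d generalizing R with
  | zero =>
    have h := spanFinrank_maximalIdeal (R := R)
    rw [hd, Nat.cast_inj, Submodule.spanFinrank_eq_zero_iff_eq_bot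
      (IsNoetherian.noetherian _)] at h
    exact (IsLocalRing.isField_iff_maximalIdeal_eq.2 h).isDomain
  | succ d ih =>
    obtain ⟨x, hx, hreg, hdim⟩ := IsRegularLocalRing.exists_quotient_span_singleton hd
    have := ih hdim
    obtain ⟨P, hP, hPdim⟩ := exists_isPrime_ringKrullDim_le (R := R)
    have hPx : P ≤ Ideal.span {x} := by
      intro y hy
      by_contra hyx
      have hy0 : Ideal.Quotient.mk (Ideal.span {x}) y ≠ 0 := by
        rwa [Ne, Ideal.Quotient.eq_zero_iff_mem]
      have h1 := ringKrullDim_quotient_succ_le_of_nonZeroDivisor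
        (mem_nonZeroDivisors_of_ne_zero hy0)
      have hxJ : Ideal.Quotient.mk P x ∈ Ring.jacobson (R ⧸ P) := by
        have hsurj := Ideal.Quotient.mk_surjective (I := P)
        have := IsLocalRing.of_surjective' _ hsurj
        rw [IsLocalRing.ringJacobson_eq_maximalIdeal,
          ← IsLocalRing.map_maximalIdeal_of_surjective _ hsurj]
        exact Ideal.mem_map_of_mem _ hx
      have h2 := ringKrullDim_le_ringKrullDim_quotient_add_card {Ideal.Quotient.mk P x} (by
        simpa using hxJ)
      have hx0 : ∀ z ∈ Ideal.span {x}, (Ideal.Quotient.mk (Ideal.span {Ideal.Quotient.mk P x})).comp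
          (Ideal.Quotient.mk P) z = 0 := fun z hz => by
        obtain ⟨z, rfl⟩ := Ideal.mem_span_singleton'.1 hz
        rw [RingHom.comp_apply, Ideal.Quotient.eq_zero_iff_mem, map_mul]
        exact Ideal.mul_mem_left _ _ (Ideal.mem_span_singleton_self _)
      have hy0' : ∀ z ∈ Ideal.span {Ideal.Quotient.mk (Ideal.span {x}) y},
          Ideal.Quotient.lift (Ideal.span {x}) ((Ideal.Quotient.mk
            (Ideal.span {Ideal.Quotient.mk P x})).comp (Ideal.Quotient.mk P)) hx0 z = 0 := by
        intro z hz
        obtain ⟨z, rfl⟩ := Ideal.mem_span_singleton'.1 hz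
        rw [map_mul, Ideal.Quotient.lift_mk, RingHom.comp_apply,
          Ideal.Quotient.eq_zero_iff_mem.2 hy, map_zero, mul_zero]
      have h3 := ringKrullDim_le_of_surjective (Ideal.Quotient.lift
        (Ideal.span {Ideal.Quotient.mk (Ideal.span {x}) y})
        (Ideal.Quotient.lift (Ideal.span {x})
          ((Ideal.Quotient.mk (Ideal.span {Ideal.Quotient.mk P x})).comp (Ideal.Quotient.mk P))
          hx0) hy0') (Ideal.Quotient.lift_surjective_of_surjective _ _
            (Ideal.Quotient.lift_surjective_of_surjective _ _
              (Ideal.Quotient.mk_surjective.comp Ideal.Quotient.mk_surjective)))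
      rw [hd] at hPdim
      rw [hdim] at h1
      rw [Finset.coe_singleton, Finset.card_singleton] at h2
      have h4 := (hPdim.trans h2).trans ((add_le_add_left h3 _).trans h1)
      have : d + 1 ≤ d := by exact_mod_cast h4
      omega
    have hxP : x ∉ P := fun hxP => by
      have := hPx.antisymm ((Ideal.span_singleton_le_iff_mem _).2 hxP)
      rw [this, hdim, hd] at hPdim
      have : d + 1 ≤ d := by exact_mod_cast hPdim
      omega
    have hP0 : P = ⊥ := by
      refine Submodule.eq_bot_of_le_smul_of_le_jacobson_bot (Ideal.span {x}) P
        (IsNoetherian.noetherian P) (fun y hy => ?_) ?_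
      · obtain ⟨z, rfl⟩ := Ideal.mem_span_singleton'.1 (hPx hy)
        rw [mul_comm]
        exact Submodule.smul_mem_smul (Ideal.mem_span_singleton_self x)
          ((hP.mem_or_mem hy).resolve_right hxP)
      · rw [Ideal.span_singleton_le_iff_mem, IsLocalRing.jacobson_eq_maximalIdeal _ bot_ne_top]
        exact hx
    rw [hP0] at hP
    exact IsDomain.of_bot_isPrime R

end RegularLocal

theorem CharP.of_ringHom_of_nontrivial {p : ℕ} [Fact p.Prime] {R S : Type*} [CommRing R]
    [CommRing S] [CharP R p] [Nontrivial S] (f : R →+* S) : CharP S p := by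
  rw [CharP.charP_iff_prime_eq_zero Fact.out, ← map_natCast f, CharP.cast_eq_zero, map_zero]

theorem exists_eq_sum_pow_mul {R : Type*} [CommRing R] {p n : ℕ} {e : Fin n → R} {x : R}
    (he : ∀ r, ∃ c : Fin n → R, x ∣ r - ∑ i, c i ^ p * e i) (m : ℕ) (r : R) :
    ∃ c : ℕ → Fin n → R, x ^ m ∣ r - ∑ j ∈ Finset.range m, ∑ i, c j i ^ p * (x ^ j * e i) := by
  classical
  induction m with
  | zero => exact ⟨0, by simp⟩
  | succ m ih =>
    obtain ⟨c, u, hu⟩ := ih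
    obtain ⟨d, v, hv⟩ := he u
    refine ⟨Function.update c m d, v, ?_⟩
    have h1 : ∑ j ∈ Finset.range m, ∑ i, Function.update c m d j i ^ p * (x ^ j * e i) =
        ∑ j ∈ Finset.range m, ∑ i, c j i ^ p * (x ^ j * e i) :=
      Finset.sum_congr rfl fun j hj => by
        rw [Function.update_of_ne (Finset.mem_range.1 hj).ne]
    have h2 : ∑ i, d i ^ p * (x ^ m * e i) = x ^ m * ∑ i, d i ^ p * e i := by
      rw [Finset.mul_sum]
      exact Finset.sum_congr rfl fun i _ => by ring
    rw [Finset.sum_range_succ, h1, Function.update_self, h2, ← sub_sub, hu, ← mul_sub, hv]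
    ring

theorem dvd_of_pow_dvd_sum {R : Type*} [CommRing R] [IsDomain R] {p n : ℕ} {e : Fin n → R} {x : R}
    (hx : x ≠ 0)
    (he : ∀ c : Fin n → R, x ∣ ∑ i, c i ^ p * e i → ∀ i, x ∣ c i) (c : Fin p → Fin n → R)
    (hc : x ^ p ∣ ∑ j, ∑ i, c j i ^ p * (x ^ (j : ℕ) * e i)) (j : Fin p) (i : Fin n) :
    x ∣ c j i := by
  induction j using WellFoundedLT.induction generalizing i with
  | ind j ih =>
    refine he _ ?_ i
    have h1 : x ^ ((j : ℕ) + 1) ∣ x ^ (j : ℕ) * ∑ i, c j i ^ p * e i := by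
      have h2 : x ^ (j : ℕ) * ∑ i, c j i ^ p * e i = ∑ i, c j i ^ p * (x ^ (j : ℕ) * e i) := by
        rw [Finset.mul_sum]
        exact Finset.sum_congr rfl fun i _ => by ring
      rw [h2]
      rw [← Finset.add_sum_erase _ _ (Finset.mem_univ j)] at hc
      refine (dvd_add_left ?_).1 ((pow_dvd_pow x j.2).trans hc)
      refine Finset.dvd_sum fun j' hj' => Finset.dvd_sum fun i _ => ?_
      rcases lt_or_gt_of_ne (Finset.ne_of_mem_erase hj') with h | h
      · exact ((pow_dvd_pow x j.2).trans (pow_dvd_pow_of_dvd (ih j' h i) p)).mul_right _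
      · exact ((pow_dvd_pow x (Nat.succ_le_of_lt h)).mul_right _).mul_left _
    rw [pow_succ] at h1
    exact (mul_dvd_mul_iff_left (pow_ne_zero _ hx)).1 h1

/-- The ring `R` regarded as an `R`-algebra via the Frobenius endomorphism. -/
def Frob (_ : ℕ) (R : Type*) : Type _ := R

section Frob

variable (p : ℕ) {R : Type*} [CommRing R]

instance : CommRing (Frob p R) := inferInstanceAs (CommRing R)

/-- The identity map from `R` to its Frobenius pushforward. -/
def toFrob : R ≃+* Frob p R := RingEquiv.refl R

variable [Fact p.Prime] [CharP R p]

instance : Algebra R (Frob p R) := ((toFrob p).toRingHom.comp (frobenius R p)).toAlgebra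

theorem Frob.algebraMap_apply (r : R) : algebraMap R (Frob p R) r = toFrob p (r ^ p) := rfl

theorem Frob.smul_toFrob (r x : R) : r • toFrob p x = toFrob p (r ^ p * x) := by
  rw [Algebra.smul_def, Frob.algebraMap_apply, map_mul]

variable {p}

theorem IsFFinite.finite_frob (h : IsFFinite p R) : Module.Finite R (Frob p R) := by
  classical
  obtain ⟨s, hs⟩ := h
  refine ⟨⟨s.image (toFrob p), top_le_iff.1 fun x _ => ?_⟩⟩
  obtain ⟨x, rfl⟩ := (toFrob p).surjective x
  obtain ⟨c, hc⟩ := hs x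
  rw [hc, map_sum]
  refine Submodule.sum_mem _ fun y hy => ?_
  rw [← Frob.smul_toFrob]
  exact Submodule.smul_mem _ _ (Submodule.subset_span (Finset.mem_image_of_mem _ hy))

theorem Frob.finite_of_surjective {S : Type*} [CommRing S] [CharP S p]
    [h : Module.Finite R (Frob p R)] (f : R →+* S) (hf : Function.Surjective f) :
    Module.Finite S (Frob p S) := by
  have h1 : (frobenius R p).Finite := h
  have h2 := (RingHom.Finite.of_surjective f hf).comp h1
  rw [RingHom.frobenius_comm] at h2
  exact h2.of_comp_finite

open Pointwise in
/-- If the Frobenius of `R / x` is free for a nonzero `x` in the Jacobson radical, so is that of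
`R`. -/
theorem Frob.free_of_quotient [IsNoetherianRing R] [IsDomain R] [Module.Finite R (Frob p R)] {x : R}
    (hx : x ≠ 0) (hxJ : x ∈ (⊥ : Ideal R).jacobson) [CharP (R ⧸ Ideal.span {x}) p]
    [Module.Finite (R ⧸ Ideal.span {x}) (Frob p (R ⧸ Ideal.span {x}))]
    [Module.Free (R ⧸ Ideal.span {x}) (Frob p (R ⧸ Ideal.span {x}))] :
    Module.Free R (Frob p R) := by
  have hreg : IsSMulRegular (Frob p R) x := by
    intro y z hyz
    obtain ⟨y, rfl⟩ := (toFrob p).surjective y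
    obtain ⟨z, rfl⟩ := (toFrob p).surjective z
    simp only [Frob.smul_toFrob, EmbeddingLike.apply_eq_iff_eq] at hyz
    rw [mul_left_cancel₀ (pow_ne_zero p hx) hyz]
  have := Module.finitePresentation_of_finite R (Frob p R)
  rw [← Module.free_quotSMulTop_iff_free R (Frob p R) hxJ hreg]
  have hQ : Nontrivial (R ⧸ Ideal.span {x}) := CharP.nontrivial_of_char_ne_one
    (v := p) (Fact.out : p.Prime).ne_one
  let b := Module.finBasis (R ⧸ Ideal.span {x}) (Frob p (R ⧸ Ideal.span {x}))
  choose e he using fun i => Ideal.Quotient.mk_surjective ((toFrob p).symm (b i))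
  have hsum : ∀ c : Fin _ → R, toFrob p (Ideal.Quotient.mk (Ideal.span {x}) (∑ i, c i ^ p * e i)) =
      ∑ i, Ideal.Quotient.mk (Ideal.span {x}) (c i) • b i := fun c => by
    rw [map_sum, map_sum]
    refine Finset.sum_congr rfl fun i _ => ?_
    rw [map_mul, map_pow, ← Frob.smul_toFrob, he, RingEquiv.apply_symm_apply]
  have hspan : ∀ r, ∃ c : Fin _ → R, x ∣ r - ∑ i, c i ^ p * e i := fun r => by
    choose c hc using fun i => Ideal.Quotient.mk_surjective
      (b.repr (toFrob p (Ideal.Quotient.mk (Ideal.span {x}) r)) i)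
    refine ⟨c, ?_⟩
    rw [← Ideal.mem_span_singleton, ← Ideal.Quotient.eq]
    apply (toFrob p).injective
    rw [hsum]
    simp only [hc]
    exact (b.sum_repr _).symm
  have hli : ∀ c : Fin _ → R, x ∣ ∑ i, c i ^ p * e i → ∀ i, x ∣ c i := fun c hc i => by
    rw [← Ideal.mem_span_singleton, ← Ideal.Quotient.eq_zero_iff_mem] at hc ⊢
    refine Fintype.linearIndependent_iff.1 b.linearIndependent
      (fun i => Ideal.Quotient.mk (Ideal.span {x}) (c i)) ?_ i
    rw [← hsum, hc, map_zero]
  let mk : R →+ QuotSMulTop x (Frob p R) :=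
    (Submodule.mkQ (x • (⊤ : Submodule R (Frob p R)))).toAddMonoidHom.comp
      (toFrob p).toAddEquiv.toAddMonoidHom
  have hmk : ∀ r, mk r = 0 ↔ x ^ p ∣ r := fun r => by
    refine (Submodule.Quotient.mk_eq_zero _).trans ?_
    rw [Submodule.mem_smul_pointwise_iff_exists]
    constructor
    · rintro ⟨y, -, hy⟩
      obtain ⟨y, rfl⟩ := (toFrob p).surjective y
      rw [Frob.smul_toFrob] at hy
      exact ⟨y, ((toFrob p).injective hy).symm⟩
    · rintro ⟨y, rfl⟩
      exact ⟨toFrob p y, trivial, Frob.smul_toFrob p x y⟩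
  have hmk_smul : ∀ r s, Ideal.Quotient.mk (Ideal.span {x}) r • mk s = mk (r ^ p * s) := by
    intro r s
    change r • Submodule.Quotient.mk (p := x • (⊤ : Submodule R (Frob p R))) (toFrob p s) = _
    rw [← Submodule.Quotient.mk_smul, Frob.smul_toFrob]
    rfl
  have hmk_surj : Function.Surjective mk := by
    intro y
    obtain ⟨y, rfl⟩ := Submodule.mkQ_surjective _ y
    exact ⟨(toFrob p).symm y, rfl⟩
  let v : Fin p × Fin _ → QuotSMulTop x (Frob p R) := fun a => mk (x ^ (a.1 : ℕ) * e a.2)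
  have hv : LinearIndependent (R ⧸ Ideal.span {x}) v := by
    rw [Fintype.linearIndependent_iff]
    intro g hg a
    choose c hc using fun a => Ideal.Quotient.mk_surjective (g a)
    simp only [← hc, v, hmk_smul] at hg
    rw [← map_sum, hmk, Fintype.sum_prod_type] at hg
    rw [← hc, Ideal.Quotient.eq_zero_iff_mem, Ideal.mem_span_singleton]
    exact dvd_of_pow_dvd_sum hx hli (fun j i => c (j, i)) hg a.1 a.2
  refine Module.Free.of_basis (Module.Basis.mk hv fun y _ => ?_)
  obtain ⟨r, rfl⟩ := hmk_surj y
  obtain ⟨c, hc⟩ := exists_eq_sum_pow_mul hspan p r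
  rw [← hmk, map_sub, sub_eq_zero] at hc
  rw [hc, map_sum]
  refine Submodule.sum_mem _ fun j hj => ?_
  rw [map_sum]
  refine Submodule.sum_mem _ fun i _ => ?_
  rw [← hmk_smul]
  exact Submodule.smul_mem _ _ (Submodule.subset_span ⟨(⟨j, Finset.mem_range.1 hj⟩, i), rfl⟩)

/-- One direction of a theorem of Kunz: the Frobenius of an `F`-finite regular local ring is
free. -/
theorem IsRegularLocalRing.free_frob [IsRegularLocalRing R] [Module.Finite R (Frob p R)] :
    Module.Free R (Frob p R) := by
  obtain ⟨d, hd⟩ : ∃ d : ℕ, ringKrullDim R = d := ⟨_, (spanFinrank_maximalIdeal (R := R)).symm⟩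
  induction d generalizing R with
  | zero =>
    have h := spanFinrank_maximalIdeal (R := R)
    rw [hd, Nat.cast_inj, Submodule.spanFinrank_eq_zero_iff_eq_bot
      (IsNoetherian.noetherian _)] at h
    let := (IsLocalRing.isField_iff_maximalIdeal_eq.2 h).toField
    exact Module.Free.of_divisionRing R (Frob p R)
  | succ d ih =>
    obtain ⟨x, hx, hreg, hdim⟩ := IsRegularLocalRing.exists_quotient_span_singleton hd
    have : CharP (R ⧸ Ideal.span {x}) p :=
      CharP.of_ringHom_of_nontrivial (Ideal.Quotient.mk _)
    have := Frob.finite_of_surjective (p := p) _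
      (Ideal.Quotient.mk_surjective (I := Ideal.span {x}))
    have := ih hdim
    have := IsRegularLocalRing.isDomain (R := R)
    refine Frob.free_of_quotient (x := x) ?_ ?_
    · rintro rfl
      have h := ringKrullDim_eq_of_ringEquiv (RingEquiv.quotientBot R)
      rw [← Ideal.span_zero, ← Set.singleton_zero] at h
      rw [h, hd, Nat.cast_inj] at hdim
      omega
    · rwa [IsLocalRing.jacobson_eq_maximalIdeal _ bot_ne_top]

end Frob

section Frob

variable {p : ℕ} [Fact p.Prime]

instance Frob.instAlgebra (A B : Type*) [CommRing A] [CommRing B] [Algebra A B] :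
    Algebra (Frob p A) (Frob p B) :=
  inferInstanceAs (Algebra A B)

theorem Frob.exists_linearMap_apply_one {R : Type*} [CommRing R] [IsLocalRing R] [CharP R p]
    [Module.Finite R (Frob p R)] [Module.Free R (Frob p R)] :
    ∃ σ : Frob p R →ₗ[R] R, σ 1 = 1 := by
  let b := Module.finBasis R (Frob p R)
  obtain ⟨i, hi⟩ : ∃ i, IsUnit (b.repr 1 i) := by
    by_contra! h
    have h1 : (1 : Frob p R) ∈ maximalIdeal R • (⊤ : Submodule R (Frob p R)) := by
      rw [← b.sum_repr 1]
      exact Submodule.sum_mem _ fun i _ =>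
        Submodule.smul_mem_smul ((mem_maximalIdeal _).2 (h i)) trivial
    rw [Ideal.smul_top_eq_map] at h1
    have h2 : (maximalIdeal R).map (algebraMap R (Frob p R)) ≤
        (maximalIdeal R).comap (toFrob p).symm.toRingHom :=
      Ideal.map_le_iff_le_comap.2 fun r hr => Ideal.pow_mem_of_mem _ hr p (Fact.out : p.Prime).pos
    exact (Ideal.ne_top_iff_one _).1 (maximalIdeal.isMaximal R).ne_top
      (by simpa using h2 h1)
  obtain ⟨u, hu⟩ := hi
  exact ⟨(u⁻¹ : Rˣ).1 • b.coord i, by simp [← hu]⟩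

variable {A B : Type*} [CommRing A] [CommRing B] [CharP A p] [CharP B p] [IsLocalRing A]
  [IsLocalRing B] [IsNoetherianRing A] [IsNoetherianRing B] [Algebra A B] [Module.Flat A B]
  [IsLocalHom (algebraMap A B)]

/-- A Frobenius splitting of `A` yields one of `B` for a flat local homomorphism `A → B` with
regular closed fiber `B / J`. -/
theorem Frob.exists_linearMap_isUnit_apply_one [Module.Finite A (Frob p A)]
    [Module.Finite B (Frob p B)] {J : Ideal B} (hJ : J = (maximalIdeal A).map (algebraMap A B))
    [IsRegularLocalRing (B ⧸ J)] (φ : Frob p A →ₗ[A] A) (hφ : φ 1 = 1) :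
    ∃ ψ : Frob p B →ₗ[B] B, IsUnit (ψ 1) := by
  let : Algebra (Frob p A) (B ⊗[A] Frob p A) := Algebra.TensorProduct.rightAlgebra
  have : IsLocalRing (Frob p A) := ‹IsLocalRing A›
  have : IsNoetherianRing (Frob p A) := ‹IsNoetherianRing A›
  have : IsLocalHom (algebraMap A (Frob p A)) :=
    ⟨fun a ha => (isUnit_pow_iff (Fact.out : p.Prime).ne_zero).1 ha⟩
  have : Module.Flat (Frob p A) (Frob p B) := ‹Module.Flat A B›
  let : Algebra A (Frob p B) := ((algebraMap B (Frob p B)).comp (algebraMap A B)).toAlgebra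
  have : IsScalarTower A B (Frob p B) := .of_algebraMap_eq fun _ => rfl
  have : IsScalarTower A (Frob p A) (Frob p B) := .of_algebraMap_eq fun a =>
    (map_pow (algebraMap A B) a p).symm
  let : Algebra (B ⊗[A] Frob p A) (Frob p B) :=
    (Algebra.TensorProduct.lift (Algebra.ofId B (Frob p B))
      (IsScalarTower.toAlgHom A (Frob p A) (Frob p B)) fun _ _ => .all _ _).toAlgebra
  have : IsScalarTower B (B ⊗[A] Frob p A) (Frob p B) := .of_algebraMap_eq fun b => by
    exact (AlgHom.commutes (Algebra.TensorProduct.lift (Algebra.ofId B (Frob p B))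
      (IsScalarTower.toAlgHom A (Frob p A) (Frob p B)) fun _ _ => .all _ _) b).symm
  have : IsScalarTower (Frob p A) (B ⊗[A] Frob p A) (Frob p B) := .of_algebraMap_eq fun b => by
    exact ((Algebra.TensorProduct.lift_tmul (Algebra.ofId B (Frob p B))
      (IsScalarTower.toAlgHom A (Frob p A) (Frob p B)) (fun _ _ => .all _ _) 1 b).trans
        (by rw [map_one, one_mul]; rfl)).symm
  have : Module.Finite (B ⊗[A] Frob p A) (Frob p B) :=
    Module.Finite.of_restrictScalars_finite B _ _
  have : IsNoetherianRing (B ⊗[A] Frob p A) := .of_finite B _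
  have : Module.Flat (Frob p A) (B ⊗[A] Frob p A) :=
    Module.Flat.isBaseChange (R := A) (M := B) (S := Frob p A) (N := B ⊗[A] Frob p A)
      (Algebra.IsPushout.out (R := A) (S := Frob p A) (R' := B))
  have : CharP (B ⧸ J) p := CharP.of_ringHom_of_nontrivial (Ideal.Quotient.mk J)
  have := Frob.finite_of_surjective (p := p) _ (Ideal.Quotient.mk_surjective (I := J))
  have := IsRegularLocalRing.free_frob (R := B ⧸ J) (p := p)
  let : Module B (Frob p (B ⧸ J)) := Module.compHom _ (Ideal.Quotient.mk J)
  have : IsScalarTower B (B ⧸ J) (Frob p (B ⧸ J)) := .of_algebraMap_smul fun _ _ => rfl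
  obtain ⟨σ, hσ⟩ := Frob.exists_linearMap_apply_one (p := p) (R := B ⧸ J)
  let π : Frob p B →ₗ[B] Frob p (B ⧸ J) :=
    { toFun := Ideal.Quotient.mk J
      map_add' := map_add (Ideal.Quotient.mk J)
      map_smul' := fun b x => by
        obtain ⟨x, rfl⟩ := (toFrob p).surjective x
        rw [Frob.smul_toFrob]
        exact (map_mul (Ideal.Quotient.mk J) (b ^ p) x).trans (by rw [map_pow]; rfl) }
  refine exists_linearMap_isUnit_apply (TensorProduct.isBaseChange A (Frob p A) B) hJ π
    (Ideal.Quotient.mk_surjective (I := J)) (fun x => ?_) (σ.restrictScalars B) 1 ?_ φ hφ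
  · have h : π x = 0 ↔ (toFrob p).symm x ∈ J := Ideal.Quotient.eq_zero_iff_mem
    rw [h, Ideal.smul_top_eq_map, hJ]
    rfl
  · exact hσ

end Frob

section Localization

variable {p : ℕ} [Fact p.Prime] {R R' : Type*} [CommRing R] [CommRing R'] [Algebra R R']
  [CharP R p] [CharP R' p] [Module R (Frob p R')] [IsScalarTower R R' (Frob p R')]

variable (p R R') in
/-- The Frobenius pushforward of the structure map of an algebra. -/
def Frob.mapLinearMap : Frob p R →ₗ[R] Frob p R' where
  toFun := algebraMap R R'
  map_add' := map_add (algebraMap R R')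
  map_smul' r x := by
    obtain ⟨x, rfl⟩ := (toFrob p).surjective x
    rw [Frob.smul_toFrob]
    change toFrob p (algebraMap R R' (r ^ p * x)) = r • toFrob p (algebraMap R R' x)
    rw [← algebraMap_smul R' r, Frob.smul_toFrob, map_mul, map_pow]

theorem Frob.mapLinearMap_toFrob (r : R) :
    Frob.mapLinearMap p R R' (toFrob p r) = toFrob p (algebraMap R R' r) := rfl

/-- Frobenius pushforward commutes with localization. -/
theorem Frob.isLocalizedModule (W : Submonoid R) [IsLocalization W R'] :
    IsLocalizedModule W (Frob.mapLinearMap p R R') where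
  map_units s := by
    obtain ⟨u, hu⟩ := IsLocalization.map_units R' s
    rw [Module.End.isUnit_iff]
    convert MulAction.bijective (β := Frob p R') u using 1
    ext y
    rw [Module.algebraMap_end_apply, Units.smul_def, hu, algebraMap_smul]
  surj y := by
    obtain ⟨y, rfl⟩ := (toFrob p).surjective y
    obtain ⟨⟨r, s⟩, h⟩ := IsLocalization.surj W y
    refine ⟨⟨toFrob p (s ^ (p - 1) * r), s⟩, ?_⟩
    rw [Submonoid.smul_def, ← algebraMap_smul R' (s : R), Frob.smul_toFrob,
      Frob.mapLinearMap_toFrob, map_mul (algebraMap R R'), ← h, map_pow, mul_left_comm,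
      ← pow_succ,
      Nat.sub_add_cancel (Fact.out : p.Prime).one_le, mul_comm]
  exists_of_eq {x y} h := by
    obtain ⟨x, rfl⟩ := (toFrob p).surjective x
    obtain ⟨y, rfl⟩ := (toFrob p).surjective y
    rw [Frob.mapLinearMap_toFrob, Frob.mapLinearMap_toFrob, EmbeddingLike.apply_eq_iff_eq] at h
    obtain ⟨c, hc⟩ := (IsLocalization.eq_iff_exists W R').1 h
    refine ⟨c, ?_⟩
    rw [Submonoid.smul_def, Submonoid.smul_def, Frob.smul_toFrob, Frob.smul_toFrob,
      ← Nat.sub_add_cancel (Fact.out : p.Prime).one_le, pow_succ, mul_assoc, hc, mul_assoc]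

theorem Frob.exists_linearMap_localization (W : Submonoid R) [IsLocalization W R']
    (φ : Frob p R →ₗ[R] R) (hφ : φ 1 = 1) : ∃ ψ : Frob p R' →ₗ[R'] R', ψ 1 = 1 := by
  have := Frob.isLocalizedModule (p := p) (R := R) (R' := R') W
  refine ⟨(IsLocalizedModule.map W (Frob.mapLinearMap p R R')
    (Algebra.linearMap R R') φ).extendScalarsOfIsLocalization W R', ?_⟩
  have h := IsLocalizedModule.map_apply W (Frob.mapLinearMap p R R') (Algebra.linearMap R R') φ 1
  rw [hφ, Algebra.linearMap_apply, map_one (algebraMap R R')] at h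
  have h1 : Frob.mapLinearMap p R R' 1 = 1 := map_one (algebraMap R R')
  rwa [h1] at h

end Localization

theorem IsFPure.exists_linearMap {p : ℕ} [Fact p.Prime] {R : Type*} [CommRing R] [CharP R p]
    (h : IsFPure p R) : ∃ φ : Frob p R →ₗ[R] R, φ 1 = 1 := by
  obtain ⟨φ, hφ, h1⟩ := h
  exact ⟨{ toFun := φ, map_add' := map_add φ, map_smul' := hφ }, h1⟩

/-- Frobenius splittings can be detected at the maximal ideals. -/
theorem isFPure_of_forall_isMaximal {p : ℕ} [Fact p.Prime] {R : Type*} [CommRing R] [CharP R p]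
    (h : ∀ (m : Ideal R) [m.IsMaximal], ∃ φ : Frob p R →ₗ[R] R, φ 1 ∉ m) : IsFPure p R := by
  obtain ⟨φ, hφ⟩ : ∃ φ : Frob p R →ₗ[R] R, φ 1 = 1 := by
    by_contra! h1
    obtain ⟨m, hm, hle⟩ := Ideal.exists_le_maximal
      (LinearMap.range (LinearMap.applyₗ (R := R) (M₂ := R) (1 : Frob p R)))
      ((Ideal.ne_top_iff_one _).2 fun ⟨φ, hφ⟩ => h1 φ hφ)
    obtain ⟨φ, hφ⟩ := h m
    exact hφ (hle ⟨φ, rfl⟩)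
  refine ⟨φ.toAddMonoidHom.comp (toFrob p (R := R)).toRingHom.toAddMonoidHom, fun r x => ?_, hφ⟩
  exact (congrArg φ (Frob.smul_toFrob p r x).symm).trans (map_smul φ r _)

theorem IsRegularLocal.isRegularLocalRing {A : Type*} [CommRing A] (h : IsRegularLocal A) :
    IsRegularLocalRing A := by
  obtain ⟨_, _, s, hs, hdim⟩ := h
  refine .of_spanFinrank_maximalIdeal_le _ ?_
  rw [IsLocalRing.jacobson_eq_maximalIdeal _ bot_ne_top] at hs
  rw [← hdim, ← hs]
  have h : (Ideal.span (s : Set A)).spanFinrank ≤ _ :=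
    Submodule.spanFinrank_span_le_ncard_of_finite s.finite_toSet
  rw [Set.ncard_coe_finset] at h
  exact (Nat.cast_le (α := WithBot ℕ∞)).2 h

/-- If `R → S` is a flat homomorphism of `F`-finite Noetherian rings of prime
characteristic `p` with regular fibers (for every prime `𝔮` of `S` lying over `𝔭` of `R`,
the localization of the fiber ring at `𝔮`, i.e. `S_𝔮 / 𝔭 S_𝔮`, is a regular local ring),
and `R` is `F`-pure, then `S` is `F`-pure. -/
theorem fPure_of_flat_regular_fibers (R S : Type*) [CommRing R] [CommRing S]
    [IsNoetherianRing R] [IsNoetherianRing S] (p : ℕ) (hp : p.Prime)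
    [CharP R p] [CharP S p] (hFFR : IsFFinite p R) (hFFS : IsFFinite p S)
    [Algebra R S] [Module.Flat R S]
    (hreg : ∀ (𝔮 : Ideal S) [𝔮.IsPrime],
      IsRegularLocal (Localization.AtPrime 𝔮 ⧸
        Ideal.map (algebraMap S (Localization.AtPrime 𝔮))
          (Ideal.map (algebraMap R S) (𝔮.comap (algebraMap R S)))))
    (hFP : IsFPure p R) :
    IsFPure p S := by
  have : Fact p.Prime := ⟨hp⟩
  have := hFFR.finite_frob
  have := hFFS.finite_frob
  obtain ⟨φ, hφ⟩ := hFP.exists_linearMap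
  refine isFPure_of_forall_isMaximal fun 𝔮 _ => ?_
  let 𝔭 := 𝔮.comap (algebraMap R S)
  let A := Localization.AtPrime 𝔭
  let B := Localization.AtPrime 𝔮
  have : CharP A p := CharP.of_ringHom_of_nontrivial (algebraMap R A)
  have : CharP B p := CharP.of_ringHom_of_nontrivial (algebraMap S B)
  let : Algebra A B := (Localization.localRingHom 𝔭 𝔮 (algebraMap R S) rfl).toAlgebra
  have : IsLocalHom (algebraMap A B) := Localization.isLocalHom_localRingHom 𝔭 𝔮 _ rfl
  have : Module.Flat A B := RingHom.Flat.localRingHom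
    (RingHom.flat_algebraMap_iff.2 ‹Module.Flat R S›) 𝔮 𝔭 rfl
  let : Module R (Frob p A) := Module.compHom _ (algebraMap R A)
  let : Module S (Frob p B) := Module.compHom _ (algebraMap S B)
  have : IsScalarTower R A (Frob p A) := .of_algebraMap_smul fun _ _ => rfl
  have : IsScalarTower S B (Frob p B) := .of_algebraMap_smul fun _ _ => rfl
  have := Frob.isLocalizedModule (p := p) (R' := A) 𝔭.primeCompl
  have := Frob.isLocalizedModule (p := p) (R' := B) 𝔮.primeCompl
  have : Module.Finite A (Frob p A) :=
    .of_isLocalizedModule 𝔭.primeCompl (Frob.mapLinearMap p R A)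
  have : Module.Finite B (Frob p B) :=
    .of_isLocalizedModule 𝔮.primeCompl (Frob.mapLinearMap p S B)
  obtain ⟨φA, hφA⟩ := Frob.exists_linearMap_localization (R' := A) 𝔭.primeCompl φ hφ
  have hJ : Ideal.map (algebraMap S B) (Ideal.map (algebraMap R S) 𝔭) =
      (maximalIdeal A).map (algebraMap A B) := by
    rw [← Localization.AtPrime.map_eq_maximalIdeal, Ideal.map_map, Ideal.map_map]
    congr 1
    ext r
    exact (Localization.localRingHom_to_map 𝔭 𝔮 (algebraMap R S) rfl r).symm
  have := (hreg 𝔮).isRegularLocalRing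
  obtain ⟨ψ, hψ⟩ := Frob.exists_linearMap_isUnit_apply_one hJ φA hφA
  have := Module.finitePresentation_of_finite S (Frob p S)
  obtain ⟨h, s, hh⟩ := Module.FinitePresentation.exists_lift_of_isLocalizedModule 𝔮.primeCompl
    (Algebra.linearMap S B) (ψ.restrictScalars S ∘ₗ Frob.mapLinearMap p S B)
  refine ⟨h, fun h1 => ?_⟩
  have h2 : algebraMap S B (h 1) = algebraMap S B s * ψ 1 :=
    (LinearMap.congr_fun hh 1).trans ((Algebra.smul_def (s : S) _).trans
      (congrArg (algebraMap S B s * ·) (congrArg ψ (map_one (algebraMap S B)))))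
  refine (IsLocalization.AtPrime.isUnit_to_map_iff B 𝔮 (h 1)).1 ?_ h1
  rw [h2]
  exact (IsLocalization.map_units B s).mul hψ
end

section
/- Let p be a prime and let (R, 𝔪) → (S, 𝔫) be a flat local homomorphism of F-finite Noetherian local rings of characteristic p whose closed fiber S/𝔪S is a regular local ring. If R is F-pure, then S is F-pure. -/
section FlatFrobenius

open IsLocalRing TensorProduct

universe u v

/-- `u` is a nonzero element killed by `m` which generates the submodule of all elements killed
by `m`. -/
structure IsSocleGenerator {B : Type*} [CommRing B] (m : Ideal B) {W : Type*} [AddCommGroup W]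
    [Module B W] (u : W) : Prop where
  ne_zero : u ≠ 0
  smul_eq_zero : ∀ a ∈ m, a • u = 0
  mem_span : ∀ z : W, (∀ a ∈ m, a • z = 0) → ∃ c : B, z = c • u

section LocalDuality

variable {B : Type*} [CommRing B]

theorem exists_smul_ne_zero_of_pow_smul_eq_zero {m : Ideal B} {W : Type*} [AddCommGroup W]
    [Module B W] (N : ℕ) (w : W) (hw : w ≠ 0) (hN : ∀ a ∈ m ^ N, a • w = 0) :
    ∃ c : B, c • w ≠ 0 ∧ ∀ a ∈ m, a • c • w = 0 := by
  induction N generalizing w with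
  | zero => exact absurd (by simpa using hN 1 (by simp)) hw
  | succ N ih =>
    by_cases h : ∀ a ∈ m, a • w = 0
    · exact ⟨1, by simpa using hw, by simpa using h⟩
    · push Not at h
      obtain ⟨a, ha, haw⟩ := h
      obtain ⟨c, hc, hc'⟩ := ih (a • w) haw fun b hb => by
        rw [smul_smul]; exact hN _ (by rw [pow_succ]; exact Ideal.mul_mem_mul hb ha)
      exact ⟨c * a, by simpa [mul_smul] using hc, by simpa [mul_smul] using hc'⟩

theorem IsSocleGenerator.injective_of_apply_ne_zero {m : Ideal B} [m.IsMaximal] {W P : Type*}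
    [AddCommGroup W] [Module B W] [AddCommGroup P] [Module B P] {u : W}
    (hu : IsSocleGenerator m u) {N : ℕ} (hN : ∀ a ∈ m ^ N, ∀ w : W, a • w = 0)
    (f : W →ₗ[B] P) (hf : f u ≠ 0) : Function.Injective f := by
  rw [injective_iff_map_eq_zero]
  intro w hw
  by_contra hw0
  obtain ⟨c, hc, hc'⟩ := exists_smul_ne_zero_of_pow_smul_eq_zero N w hw0 fun a ha => hN a ha w
  obtain ⟨d, hd⟩ := hu.mem_span _ hc'
  have hdm : d ∉ m := fun h => hc (by rw [hd, hu.smul_eq_zero d h])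
  obtain ⟨e, i, hi, he⟩ := Ideal.IsMaximal.exists_inv ‹m.IsMaximal› hdm
  apply hf
  have : u = e • d • u := by
    calc u = (e * d + i) • u := by rw [he, one_smul]
      _ = _ := by rw [add_smul, hu.smul_eq_zero i hi, add_zero, mul_smul]
  rw [this, ← hd, map_smul, map_smul, hw, smul_zero, smul_zero]

theorem length_le_length_add_length {M N P : Type*} [AddCommGroup M] [AddCommGroup N]
    [AddCommGroup P] [Module B M] [Module B N] [Module B P] (f : N →ₗ[B] M) (g : M →ₗ[B] P)
    (h : Function.Exact f g) : Module.length B M ≤ Module.length B N + Module.length B P := by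
  rw [Module.length_eq_add_of_exact (LinearMap.ker g).subtype g.rangeRestrict
    (Submodule.subtype_injective _) g.surjective_rangeRestrict
    (by rw [LinearMap.exact_iff]; simp)]
  gcongr
  · rw [h.linearMap_ker_eq]
    exact Module.length_le_of_surjective f.rangeRestrict f.surjective_rangeRestrict
  · exact Module.length_le_of_injective (LinearMap.range g).subtype (Submodule.subtype_injective _)

theorem IsSocleGenerator.isSimpleModule_span {m : Ideal B} [m.IsMaximal] {W : Type*}
    [AddCommGroup W] [Module B W] {u : W} (hu : IsSocleGenerator m u) :
    IsSimpleModule B (Submodule.span B {u}) := by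
  have h : Ideal.torsionOf B W u = m := by
    refine (Ideal.IsMaximal.eq_of_le ‹_› ?_ fun a ha => hu.smul_eq_zero a ha).symm
    rw [Ne, Ideal.torsionOf_eq_top_iff]
    exact hu.ne_zero
  refine isSimpleModule_iff_quot_maximal.2 ⟨m, ‹_›, ⟨?_⟩⟩
  rw [← h]
  exact (Ideal.quotTorsionOfEquivSpanSingleton B W u).symm

theorem isFiniteLength_of_finite [IsArtinianRing B] (X : Type*) [AddCommGroup X] [Module B X]
    [Module.Finite B X] : IsFiniteLength B X :=
  isFiniteLength_iff_isNoetherian_isArtinian.2 ⟨inferInstance, inferInstance⟩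

theorem length_eq_length_ker_add_length_range {M P : Type*} [AddCommGroup M]
    [AddCommGroup P] [Module B M] [Module B P] (g : M →ₗ[B] P) :
    Module.length B M =
      Module.length B (LinearMap.ker g) + Module.length B (LinearMap.range g) :=
  Module.length_eq_add_of_exact (LinearMap.ker g).subtype g.rangeRestrict
    (Submodule.subtype_injective _) g.surjective_rangeRestrict
    (by rw [LinearMap.exact_iff]; simp)

theorem range_eq_top_of_length_le {M P : Type*} [AddCommGroup M]
    [AddCommGroup P] [Module B M] [Module B P] (g : M →ₗ[B] P)
    (hP : Module.length B P ≠ ⊤)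
    (h : Module.length B P ≤ Module.length B (LinearMap.range g)) : LinearMap.range g = ⊤ := by
  have h1 := Module.length_eq_add_of_exact (LinearMap.range g).subtype (LinearMap.range g).mkQ
    (Submodule.subtype_injective _) (Submodule.mkQ_surjective _) (LinearMap.exact_subtype_mkQ _)
  have h2 : Module.length B (P ⧸ LinearMap.range g) = 0 := by
    rw [h1] at h hP
    generalize Module.length B (LinearMap.range g) = a at *
    generalize Module.length B (P ⧸ LinearMap.range g) = b at *
    lift a to ℕ using fun h => hP (by simp [h])
    lift b to ℕ using fun h => hP (by simp [h])
    norm_cast at *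
    omega
  rw [Module.length_eq_zero_iff] at h2
  exact Submodule.Quotient.subsingleton_iff.1 h2

variable [IsLocalRing B]

theorem IsSocleGenerator.length_hom_le {W : Type*} [AddCommGroup W] [Module B W] {u : W}
    (hu : IsSocleGenerator (maximalIdeal B) u) {X : Type*} [AddCommGroup X] [Module B X]
    (hX : IsFiniteLength B X) : Module.length B (X →ₗ[B] W) ≤ Module.length B X := by
  induction hX with
  | of_subsingleton => simp
  | @of_simple_quotient X _ _ N hs hN ih =>
    rw [Module.length_eq_add_of_exact N.subtype N.mkQ (Submodule.subtype_injective _)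
      (Submodule.mkQ_surjective _) (LinearMap.exact_subtype_mkQ N), add_comm]
    refine (length_le_length_add_length (LinearMap.lcomp B W N.mkQ) (LinearMap.lcomp B W N.subtype)
      ?_).trans (add_le_add ?_ ih)
    · intro f
      constructor
      · intro hf
        exact ⟨N.liftQ f fun x hx => by simpa using LinearMap.congr_fun hf ⟨x, hx⟩,
          LinearMap.ext fun _ => rfl⟩
      · rintro ⟨g, rfl⟩
        ext x
        simp [(Submodule.Quotient.mk_eq_zero N).2 x.2]
    · have := IsSimpleModule.nontrivial B (X ⧸ N)
      obtain ⟨x, hx⟩ := exists_ne (0 : X ⧸ N)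
      have hx' : ∀ a ∈ maximalIdeal B, a • x = 0 := by
        intro a ha
        have := IsLocalRing.eq_maximalIdeal
          (IsSimpleModule.annihilator_isMaximal (R := B) (M := X ⧸ N))
        rw [← this] at ha
        exact Module.mem_annihilator.1 ha x
      have hsp : IsSimpleModule B (Submodule.span B {u}) :=
        hu.isSimpleModule_span
      rw [Module.length_eq_one B (X ⧸ N), ← Module.length_eq_one B (Submodule.span B {u})]
      let ev : ((X ⧸ N) →ₗ[B] W) →ₗ[B] Submodule.span B {u} :=
        (LinearMap.applyₗ x).codRestrict _ fun f => by
          obtain ⟨c, hc⟩ := hu.mem_span (f x) fun a ha => by rw [← map_smul, hx' a ha, map_zero]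
          rw [LinearMap.applyₗ_apply_apply, hc]
          exact Submodule.smul_mem _ _ (Submodule.mem_span_singleton_self u)
      refine Module.length_le_of_injective ev ?_
      rw [injective_iff_map_eq_zero]
      intro f hf
      have hf : f x = 0 := congrArg Subtype.val hf
      refine LinearMap.ext fun y => ?_
      obtain ⟨c, rfl⟩ := (IsSimpleModule.toSpanSingleton_surjective B hx) y
      simp [hf]

variable [IsArtinianRing B] {W : Type*} [AddCommGroup W] [Module B W] {u : W}

theorem IsSocleGenerator.baer (hu : IsSocleGenerator (maximalIdeal B) u)
    (hl : Module.length B B ≤ Module.length B W) : Module.Baer B W := by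
  intro I g
  let r := LinearMap.lcomp B W I.subtype
  have hI : Module.length B (I →ₗ[B] W) ≤ Module.length B I :=
    hu.length_hom_le (isFiniteLength_of_finite I)
  have hq : Module.length B ((B ⧸ I) →ₗ[B] W) ≤ Module.length B (B ⧸ I) :=
    hu.length_hom_le (isFiniteLength_of_finite _)
  have hBI := Module.length_eq_add_of_exact I.subtype I.mkQ
    (Submodule.subtype_injective _) (Submodule.mkQ_surjective _) (LinearMap.exact_subtype_mkQ I)
  have hker : Module.length B (LinearMap.ker r) ≤ Module.length B (B ⧸ I) := by
    refine le_trans ?_ hq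
    have hle : LinearMap.ker r ≤ LinearMap.range (LinearMap.lcomp B W I.mkQ) := by
      intro f hf
      exact ⟨I.liftQ f fun x hx => by simpa [r] using LinearMap.congr_fun hf ⟨x, hx⟩,
        LinearMap.ext fun _ => rfl⟩
    exact (Module.length_le_of_injective (Submodule.inclusion hle)
      (Submodule.inclusion_injective hle)).trans
      (Module.length_le_of_surjective _ (LinearMap.lcomp B W I.mkQ).surjective_rangeRestrict)
  have hr := length_eq_length_ker_add_length_range r
  rw [(LinearMap.ringLmapEquivSelf B B W).length_eq] at hr
  have hItop : Module.length B I ≠ ⊤ :=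
    Module.length_ne_top_iff.2 (isFiniteLength_of_finite I)
  have hQtop : Module.length B (B ⧸ I) ≠ ⊤ :=
    Module.length_ne_top_iff.2 (isFiniteLength_of_finite _)
  have key : LinearMap.range r = ⊤ := by
    refine range_eq_top_of_length_le r (ne_top_of_le_ne_top hItop hI) (hI.trans ?_)
    rw [hr, hBI] at hl
    have := hl.trans (add_le_add_left hker _)
    rw [add_comm (Module.length B (B ⧸ I))] at this
    exact (ENat.add_le_add_iff_right hQtop).1 this
  obtain ⟨f, hf⟩ := LinearMap.range_eq_top.1 key g
  exact ⟨f, fun x hx => by rw [← hf]; rfl⟩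

theorem IsSocleGenerator.length_le (hu : IsSocleGenerator (maximalIdeal B) u) :
    Module.length B W ≤ Module.length B B := by
  rw [← (LinearMap.ringLmapEquivSelf B B W).length_eq]
  exact hu.length_hom_le (isFiniteLength_of_finite B)

theorem IsSocleGenerator.isFiniteLength (hu : IsSocleGenerator (maximalIdeal B) u) :
    IsFiniteLength B W :=
  Module.length_ne_top_iff.1 (ne_top_of_le_ne_top
    (Module.length_ne_top_iff.2 (isFiniteLength_of_finite B)) hu.length_le)

theorem IsSocleGenerator.eq_zero_of_smul_eq_zero (hu : IsSocleGenerator (maximalIdeal B) u)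
    (hl : Module.length B B ≤ Module.length B W) {b : B} (hb : ∀ w : W, b • w = 0) : b = 0 := by
  let I := Ideal.span {b}
  have h1 : Module.length B W ≤ Module.length B (B ⧸ I) := by
    rw [← (LinearMap.ringLmapEquivSelf B B W).length_eq]
    refine le_trans ?_ (hu.length_hom_le (isFiniteLength_of_finite (B ⧸ I)))
    refine Module.length_le_of_surjective (LinearMap.lcomp B W I.mkQ) fun f => ?_
    refine ⟨I.liftQ f ?_, LinearMap.ext fun _ => rfl⟩
    rw [Ideal.span_le, Set.singleton_subset_iff]
    change f b = 0
    rw [← mul_one b, ← smul_eq_mul, map_smul, hb]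
  have h2 := Module.length_eq_add_of_exact I.subtype I.mkQ
    (Submodule.subtype_injective _) (Submodule.mkQ_surjective _) (LinearMap.exact_subtype_mkQ I)
  have hQtop : Module.length B (B ⧸ I) ≠ ⊤ :=
    Module.length_ne_top_iff.2 (isFiniteLength_of_finite _)
  have h3 : Module.length B I = 0 := by
    have := hl.trans h1
    rw [h2] at this
    nth_rewrite 2 [← zero_add (Module.length B (B ⧸ I))] at this
    exact nonpos_iff_eq_zero.1 ((ENat.add_le_add_iff_right hQtop).1 this)
  rw [Module.length_eq_zero_iff] at h3
  exact congrArg Subtype.val (Subsingleton.elim (⟨b, Ideal.mem_span_singleton_self b⟩ : I) 0)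

theorem IsSocleGenerator.exists_eq_smul (hu : IsSocleGenerator (maximalIdeal B) u)
    (hl : Module.length B B ≤ Module.length B W) (f : W →ₗ[B] W) :
    ∃ b : B, ∀ w, f w = b • w := by
  let g : B →ₗ[B] (W →ₗ[B] W) := LinearMap.lsmul B W
  have hE := hu.length_hom_le hu.isFiniteLength
  have htop : Module.length B B ≠ ⊤ :=
    Module.length_ne_top_iff.2 (isFiniteLength_of_finite _)
  have hg : Function.Injective g := by
    rw [injective_iff_map_eq_zero]
    exact fun b hb => hu.eq_zero_of_smul_eq_zero hl fun w => LinearMap.congr_fun hb w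
  have key : LinearMap.range g = ⊤ := by
    refine range_eq_top_of_length_le g
      (ne_top_of_le_ne_top htop (hE.trans hu.length_le)) (hE.trans (hu.length_le.trans ?_))
    exact Module.length_le_of_injective g.rangeRestrict fun a b h => hg (congrArg Subtype.val h)
  obtain ⟨b, hb⟩ := LinearMap.range_eq_top.1 key f
  exact ⟨b, fun w => by rw [← hb]; rfl⟩

end LocalDuality

section Existence

theorem exists_linearMap_span_singleton {B M P : Type*} [CommRing B] [AddCommGroup M] [Module B M]
    [AddCommGroup P] [Module B P] (x : M) (y : P) (h : ∀ a : B, a • x = 0 → a • y = 0) :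
    ∃ f : Submodule.span B {x} →ₗ[B] P, f ⟨x, Submodule.mem_span_singleton_self x⟩ = y := by
  let e := Ideal.quotTorsionOfEquivSpanSingleton B M x
  let g : (B ⧸ Ideal.torsionOf B M x) →ₗ[B] P :=
    (Ideal.torsionOf B M x).liftQ (LinearMap.toSpanSingleton B P y) fun a ha => h a ha
  refine ⟨g ∘ₗ e.symm.toLinearMap, ?_⟩
  have : e.symm ⟨x, Submodule.mem_span_singleton_self x⟩ = Submodule.Quotient.mk 1 := by
    rw [LinearEquiv.symm_apply_eq]
    ext
    rw [Ideal.quotTorsionOfEquivSpanSingleton_apply_mk, one_smul]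
  rw [LinearMap.comp_apply, LinearEquiv.coe_coe, this]
  exact one_smul B y

theorem exists_characterModule_smul_eq_zero {C : Type*} [CommRing C] (m : Ideal C) (hm : m ≠ ⊤) :
    ∃ χ : CharacterModule C, χ ≠ 0 ∧ ∀ a ∈ m, a • χ = 0 := by
  have := Ideal.Quotient.nontrivial_iff.2 hm
  obtain ⟨χ, hχ⟩ := CharacterModule.exists_character_apply_ne_zero_of_ne_zero
    (one_ne_zero (α := C ⧸ m))
  refine ⟨χ.comp m.mkQ.toAddMonoidHom, fun h => hχ ?_, fun a ha => ?_⟩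
  · exact DFunLike.congr_fun h (1 : C)
  · refine DFunLike.ext _ _ fun x => ?_
    change χ (m.mkQ (a • x)) = 0
    rw [Submodule.mkQ_apply, (Submodule.Quotient.mk_eq_zero m).2
      (by simpa using m.mul_mem_right x ha), map_zero]

theorem exists_isSocleGenerator_of_isArtinianRing (C : Type u) [CommRing C]
    [IsLocalRing C] [IsArtinianRing C] :
    ∃ (W : Type u) (_ : AddCommGroup W) (_ : Module C W) (u : W),
      IsSocleGenerator (maximalIdeal C) u ∧ Module.length C C ≤ Module.length C W := by
  obtain ⟨χ, hχ0, hχ⟩ := exists_characterModule_smul_eq_zero (maximalIdeal C)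
    (Ideal.IsMaximal.ne_top inferInstance)
  have hB : Module.Baer C (CharacterModule C) :=
    Module.Flat.iff_characterModule_baer.1 inferInstance
  obtain ⟨K, hK⟩ : ∃ K : Submodule C (CharacterModule C), Maximal (fun K => χ ∉ K) K := by
    obtain ⟨K, -, hK⟩ := zorn_le_nonempty₀ {K : Submodule C (CharacterModule C) | χ ∉ K}
      (fun c hc hchain y hy => ⟨sSup c, by
        rw [Set.mem_ofPred_eq, Submodule.mem_sSup_of_directed ⟨y, hy⟩ hchain.directedOn]
        rintro ⟨z, hz, hz'⟩
        exact hc hz hz', fun z hz => le_sSup hz⟩) ⊥ (by simpa using hχ0)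
    exact ⟨K, hK⟩
  have hu : IsSocleGenerator (maximalIdeal C) (K.mkQ χ) := by
    refine ⟨?_, fun a ha => by rw [← map_smul, hχ a ha, map_zero], fun z hz => ?_⟩
    · rw [Submodule.mkQ_apply, Ne, Submodule.Quotient.mk_eq_zero]; exact hK.prop
    · obtain ⟨y, rfl⟩ := K.mkQ_surjective z
      by_cases hy : y ∈ K
      · exact ⟨0, by simpa using hy⟩
      have : χ ∈ K ⊔ Submodule.span C {y} := by
        by_contra h
        have := hK.le_of_ge h le_sup_left
        exact hy (this (Submodule.mem_sup_right (Submodule.mem_span_singleton_self y)))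
      obtain ⟨k, hk, w, hw, hkw⟩ := Submodule.mem_sup.1 this
      obtain ⟨c, rfl⟩ := Submodule.mem_span_singleton.1 hw
      have h1 : K.mkQ χ = c • K.mkQ y := by
        rw [← hkw, map_add, map_smul, Submodule.mkQ_apply, (Submodule.Quotient.mk_eq_zero K).2 hk,
          zero_add]
      have hc : IsUnit c := by
        by_contra hc
        rw [hz c hc, Submodule.mkQ_apply, Submodule.Quotient.mk_eq_zero] at h1
        exact hK.prop h1
      obtain ⟨c, rfl⟩ := hc
      exact ⟨(c⁻¹ : Cˣ), by rw [h1, smul_smul, Units.inv_mul, one_smul]⟩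
  refine ⟨_, inferInstance, inferInstance, K.mkQ χ, hu, ?_⟩
  refine le_trans ?_ (hu.length_hom_le hu.isFiniteLength)
  refine Module.length_le_of_injective (LinearMap.lsmul C (_ ⧸ K)) ?_
  rw [injective_iff_map_eq_zero]
  intro b hb
  by_contra hb0
  obtain ⟨n, hn⟩ := IsArtinianRing.isNilpotent_jacobson_bot (R := C)
  rw [IsLocalRing.jacobson_eq_maximalIdeal ⊥ bot_ne_top] at hn
  obtain ⟨c, hc0, hc⟩ := exists_smul_ne_zero_of_pow_smul_eq_zero (m := maximalIdeal C) n b hb0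
    (by rw [hn]; intro a ha; rw [Ideal.zero_eq_bot, Ideal.mem_bot] at ha; rw [ha, zero_smul])
  obtain ⟨f, hf⟩ := exists_linearMap_span_singleton (c • b) χ fun a ha => by
    refine hχ a fun hu => hc0 ?_
    exact (hu.smul_eq_zero).1 ha
  obtain ⟨g, hg⟩ := hB _ f
  have h2 := hg _ (Submodule.mem_span_singleton_self (c • b))
  rw [hf, ← mul_one (c • b), ← smul_eq_mul, map_smul] at h2
  refine hu.ne_zero ?_
  rw [← h2, map_smul, smul_assoc]
  change c • (LinearMap.lsmul C (_ ⧸ K) b (K.mkQ (g 1))) = 0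
  rw [hb]; simp

theorem exists_isSocleGenerator_of_pow (R : Type u) [CommRing R] [IsNoetherianRing R] (m : Ideal R)
    [m.IsMaximal] (N : ℕ) (hN : N ≠ 0) :
    ∃ (W : Type u) (_ : AddCommGroup W) (_ : Module R W) (u : W),
      IsSocleGenerator m u ∧ (∀ a ∈ m ^ N, ∀ w : W, a • w = 0) ∧ IsFiniteLength R W ∧
      Module.length R (R ⧸ m ^ N) ≤ Module.length R W := by
  let C := R ⧸ m ^ N
  have hcomap (Q : Ideal C) [hQ : Q.IsMaximal] : Q.comap (algebraMap R C) = m := by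
    have := Ideal.comap_isMaximal_of_surjective _ (Ideal.Quotient.mk_surjective (I := m ^ N))
      (K := Q)
    refine (Ideal.IsMaximal.eq_of_le ‹m.IsMaximal› this.ne_top
      (Ideal.IsPrime.le_of_pow_le (n := N) fun a ha => ?_)).symm
    rw [Ideal.mem_comap, Ideal.Quotient.eq_zero_iff_mem.2 ha]
    exact Q.zero_mem
  have hinj := Ideal.comap_injective_of_surjective (algebraMap R C) Ideal.Quotient.mk_surjective
  have : Nontrivial C := Ideal.Quotient.nontrivial_iff.2 fun h =>
    ‹m.IsMaximal›.ne_top (top_le_iff.1 (h ▸ Ideal.pow_le_self hN))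
  obtain ⟨Q, hQ⟩ := Ideal.exists_maximal C
  have : IsLocalRing C := .of_unique_max_ideal ⟨Q, hQ, fun Q' hQ' =>
    hinj ((hcomap Q').trans (hcomap Q).symm)⟩
  have hmem (a : R) : algebraMap R C a ∈ maximalIdeal C ↔ a ∈ m := by
    rw [← Ideal.mem_comap, hcomap]
  have : IsArtinianRing C := by
    rw [isArtinianRing_iff_isNilpotent_maximalIdeal]
    refine ⟨N, ?_⟩
    rw [← Ideal.map_comap_of_surjective (algebraMap R C) Ideal.Quotient.mk_surjective
      (maximalIdeal C), hcomap, ← Ideal.map_pow]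
    exact Ideal.map_quotient_self _
  obtain ⟨W, _, _, u, hu, hl⟩ := exists_isSocleGenerator_of_isArtinianRing C
  let _ : Module R W := Module.compHom W (algebraMap R C)
  have : IsScalarTower R C W := ⟨fun a b c => by
    rw [Algebra.smul_def, mul_smul]; rfl⟩
  have hmk : Function.Surjective (algebraMap R C) := Ideal.Quotient.mk_surjective
  have hsm : ∀ (a : R) (w : W), a • w = algebraMap R C a • w := fun _ _ => rfl
  refine ⟨W, _, _, u, ⟨hu.ne_zero, fun a ha => hu.smul_eq_zero _ ((hmem a).2 ha), fun z hz => ?_⟩,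
    fun a ha w => ?_, ?_, ?_⟩
  · obtain ⟨c, hc⟩ := hu.mem_span z fun a ha => by
      obtain ⟨a, rfl⟩ := hmk a
      exact hz a ((hmem a).1 ha)
    obtain ⟨c, rfl⟩ := hmk c
    exact ⟨c, hc⟩
  · rw [hsm, show algebraMap R C a = 0 from Ideal.Quotient.eq_zero_iff_mem.2 ha, zero_smul]
  · rw [← Module.length_ne_top_iff, Module.length_eq_of_surjective hmk]
    exact Module.length_ne_top_iff.2 hu.isFiniteLength
  · rw [Module.length_eq_of_surjective hmk, Module.length_eq_of_surjective hmk]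
    exact hl

end Existence

section LocalDualityQuotient

theorem IsSocleGenerator.exists_linearMap_quotient {S : Type*} [CommRing S] [IsLocalRing S]
    [IsNoetherianRing S] {N : ℕ} (hN : N ≠ 0) {W : Type*} [AddCommGroup W] [Module S W] {u : W}
    (hu : IsSocleGenerator (maximalIdeal S) u)
    (hW : ∀ a ∈ maximalIdeal S ^ N, ∀ w : W, a • w = 0)
    (hl : Module.length S (S ⧸ maximalIdeal S ^ N) ≤ Module.length S W)
    {P M : Type*} [AddCommGroup P] [Module S P] [AddCommGroup M] [Module S M]
    (hP : ∀ a ∈ maximalIdeal S ^ N, ∀ z : P, a • z = 0)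
    (Φ : M →ₗ[S] W →ₗ[S] P) {x : M} (hx : Function.Injective (Φ x)) :
    ∃ ψ : M →ₗ[S] (S ⧸ maximalIdeal S ^ N), ψ x = 1 := by
  let J := maximalIdeal S ^ N
  let B := S ⧸ J
  have hJtop : J ≠ ⊤ := fun h =>
    (Ideal.IsMaximal.ne_top inferInstance) (top_le_iff.1 (h.ge.trans (Ideal.pow_le_self hN)))
  have : Nontrivial B := Ideal.Quotient.nontrivial_iff.2 hJtop
  have hmk : Function.Surjective (algebraMap S B) := Ideal.Quotient.mk_surjective
  have : IsLocalRing B := .of_surjective' _ hmk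
  have hmax : maximalIdeal B = (maximalIdeal S).map (algebraMap S B) :=
    (map_maximalIdeal_of_surjective (algebraMap S B) hmk).symm
  have : IsArtinianRing B := by
    rw [isArtinianRing_iff_isNilpotent_maximalIdeal]
    exact ⟨N, by rw [hmax, ← Ideal.map_pow]; exact Ideal.map_quotient_self _⟩
  have hWt : Module.IsTorsionBySet S W J := fun w a => hW a a.2 w
  have hPt : Module.IsTorsionBySet S P J := fun w a => hP a a.2 w
  let _ : Module B W := hWt.module
  let _ : Module B P := hPt.module
  have : IsScalarTower S B W := hWt.isScalarTower
  have : IsScalarTower S B P := hPt.isScalarTower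
  have huB : IsSocleGenerator (maximalIdeal B) u := by
    refine ⟨hu.ne_zero, fun a ha => ?_, fun z hz => ?_⟩
    · rw [hmax, Ideal.mem_map_iff_of_surjective _ hmk] at ha
      obtain ⟨a, ha, rfl⟩ := ha
      rw [algebraMap_smul, hu.smul_eq_zero a ha]
    · obtain ⟨c, hc⟩ := hu.mem_span z fun a ha => by
        rw [← algebraMap_smul B a z]
        exact hz _ (hmax ▸ Ideal.mem_map_of_mem _ ha)
      exact ⟨algebraMap S B c, by rw [algebraMap_smul, hc]⟩
  have hlB : Module.length B B ≤ Module.length B W := by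
    rwa [← Module.length_eq_of_surjective hmk, ← Module.length_eq_of_surjective hmk]
  obtain ⟨ρ, hρ⟩ := (huB.baer hlB).extension_property
    ((Φ x).extendScalarsOfSurjective hmk) hx LinearMap.id
  let L : B →ₗ[S] W →ₗ[S] W := J.liftQ (LinearMap.lsmul S W) fun a ha =>
    LinearMap.ext fun w => hW a ha w
  have hL (b : B) (w : W) : L b w = b • w := by
    obtain ⟨b, rfl⟩ := hmk b
    exact (algebraMap_smul B b w).symm
  have hLb : Function.Bijective L := by
    constructor
    · rw [injective_iff_map_eq_zero]
      exact fun b hb => huB.eq_zero_of_smul_eq_zero hlB fun w => by rw [← hL, hb]; rfl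
    · intro f
      obtain ⟨b, hb⟩ := huB.exists_eq_smul hlB (f.extendScalarsOfSurjective hmk)
      exact ⟨b, LinearMap.ext fun w => (hL b w).trans (hb w).symm⟩
  let e := LinearEquiv.ofBijective L hLb
  refine ⟨e.symm.toLinearMap ∘ₗ (LinearMap.compRight S (ρ.restrictScalars S)) ∘ₗ Φ, ?_⟩
  change e.symm _ = 1
  rw [LinearEquiv.symm_apply_eq]
  refine LinearMap.ext fun w => ?_
  refine (LinearMap.congr_fun hρ w).trans ?_
  exact ((hL 1 w).trans (one_smul B w)).symm

end LocalDualityQuotient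

section FlatOnTorsion

variable {R : Type u} [CommRing R]

/-- `S ⊗[R] _` preserves injectivity of maps into modules killed by a power of `m`. -/
def FlatOnTorsion (m : Ideal R) (S : Type v) [AddCommGroup S] [Module R S] : Prop :=
  ∀ (X Y : Type u) [AddCommGroup X] [Module R X] [AddCommGroup Y] [Module R Y] (f : X →ₗ[R] Y),
    Function.Injective f → (∃ N : ℕ, ∀ a ∈ m ^ N, ∀ y : Y, a • y = 0) →
    Function.Injective (f.lTensor S)

theorem le_of_smul_eq_zero {m : Ideal R} [hm : m.IsMaximal] {X : Type*} [AddCommGroup X]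
    [Module R X] {N : ℕ} {x : X} (hx : x ≠ 0) (hN : ∀ a ∈ m ^ N, a • x = 0) {a : R}
    (ha : a • x = 0) : a ∈ m := by
  have hne : Ideal.torsionOf R X x ≠ ⊤ := by rwa [Ne, Ideal.torsionOf_eq_top_iff]
  obtain ⟨M, hM, hle⟩ := Ideal.exists_le_maximal _ hne
  rw [hm.eq_of_le hM.ne_top (Ideal.IsPrime.le_of_pow_le (n := N) fun b hb => hle (hN b hb))]
  exact hle ha

variable {S : Type v} [CommRing S] [Algebra R S] {m : Ideal R}

theorem FlatOnTorsion.tmul_ne_zero [m.IsMaximal] (hT : FlatOnTorsion m S)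
    (hS : m.map (algebraMap R S) ≠ ⊤) {X : Type u} [AddCommGroup X] [Module R X] {N : ℕ}
    (hN : ∀ a ∈ m ^ N, ∀ y : X, a • y = 0) {x : X} (hx : x ≠ 0) : (1 : S) ⊗ₜ[R] x ≠ 0 := by
  have := Ideal.Quotient.nontrivial_iff.2 hS
  obtain ⟨f, hf⟩ := exists_linearMap_span_singleton x (1 : S ⧸ m.map (algebraMap R S))
    fun a ha => by
    have := le_of_smul_eq_zero hx (fun a ha => hN a ha x) ha
    rw [Algebra.smul_def, mul_one, IsScalarTower.algebraMap_apply R S]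
    exact Ideal.Quotient.eq_zero_iff_mem.2 (Ideal.mem_map_of_mem _ this)
  intro h
  have h1 : (1 : S) ⊗ₜ[R] (⟨x, Submodule.mem_span_singleton_self x⟩ : Submodule.span R {x}) =
      0 := by
    refine hT _ _ (Submodule.span R {x}).subtype (Submodule.subtype_injective _) ⟨N, hN⟩ ?_
    simpa using h
  have h2 := congrArg (f.liftBaseChange S) h1
  rw [LinearMap.liftBaseChange_tmul, hf, one_smul, map_zero] at h2
  exact one_ne_zero h2

variable [IsLocalRing S]

theorem FlatOnTorsion.length_eq [m.IsMaximal] (hT : FlatOnTorsion m S)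
    (hS : m.map (algebraMap R S) = maximalIdeal S) {X : Type u} [AddCommGroup X] [Module R X]
    (hX : IsFiniteLength R X) {N : ℕ} (hN : ∀ a ∈ m ^ N, ∀ y : X, a • y = 0) :
    Module.length S (S ⊗[R] X) = Module.length R X := by
  induction hX with
  | of_subsingleton => simp [Module.length_eq_zero]
  | @of_simple_quotient X _ _ K hs hK ih =>
    have hex := lTensor_exact S (LinearMap.exact_subtype_mkQ K) K.mkQ_surjective
    rw [Module.length_eq_add_of_exact K.subtype K.mkQ K.subtype_injective K.mkQ_surjective
      (LinearMap.exact_subtype_mkQ K),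
      Module.length_eq_add_of_exact (K.subtype.baseChange S) (K.mkQ.baseChange S)
      (by rw [LinearMap.baseChange_eq_ltensor]; exact hT _ _ _ K.subtype_injective ⟨N, hN⟩)
      (by
        rw [LinearMap.baseChange_eq_ltensor]
        exact LinearMap.lTensor_surjective _ K.mkQ_surjective)
      (by rwa [LinearMap.baseChange_eq_ltensor, LinearMap.baseChange_eq_ltensor]),
      ih fun a ha y => Subtype.ext (hN a ha y)]
    congr 1
    obtain ⟨m', hm', ⟨e⟩⟩ := isSimpleModule_iff_quot_maximal.1 hs
    have hmm : m' = m := by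
      refine (Ideal.IsMaximal.eq_of_le ‹m.IsMaximal› hm'.ne_top
        (Ideal.IsPrime.le_of_pow_le (n := N) fun a ha => ?_)).symm
      rw [← Ideal.Quotient.eq_zero_iff_mem]
      obtain ⟨y, hy⟩ := e.surjective 1
      obtain ⟨y, rfl⟩ := K.mkQ_surjective y
      have := congrArg e (congrArg K.mkQ (hN a ha y))
      rw [map_smul, map_smul, hy, map_zero, map_zero, Algebra.smul_def, mul_one] at this
      exact this
    subst hmm
    rw [Module.length_eq_one R (X ⧸ K), ((e.baseChange R S _ _).trans
      (Ideal.qoutMapEquivTensorQout S).symm).length_eq]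
    have : IsSimpleModule S (S ⧸ m'.map (algebraMap R S)) :=
      isSimpleModule_iff_quot_maximal.2 ⟨_, hS ▸ maximalIdeal.isMaximal S, ⟨.refl _ _⟩⟩
    exact Module.length_eq_one S _

theorem FlatOnTorsion.isSocleGenerator [IsNoetherianRing R] [m.IsMaximal] (hT : FlatOnTorsion m S)
    (hS : m.map (algebraMap R S) = maximalIdeal S) {W : Type u} [AddCommGroup W] [Module R W]
    {w : W} (hw : IsSocleGenerator m w) {N : ℕ} (hN : ∀ a ∈ m ^ N, ∀ y : W, a • y = 0) :
    IsSocleGenerator (maximalIdeal S) ((1 : S) ⊗ₜ[R] w) := by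
  classical
  refine ⟨hT.tmul_ne_zero (hS ▸ Ideal.IsMaximal.ne_top inferInstance) hN hw.ne_zero,
    fun b hb => ?_, fun z hz => ?_⟩
  · rw [← hS] at hb
    refine Submodule.span_induction (p := fun b _ => b • ((1 : S) ⊗ₜ[R] w) = 0) ?_ (zero_smul _ _)
      (fun b c _ _ hb hc => by rw [add_smul, hb, hc, add_zero])
      (fun c b _ hb => by rw [smul_assoc, hb, smul_zero]) hb
    rintro _ ⟨a, ha, rfl⟩
    rw [algebraMap_smul, ← tmul_smul, hw.smul_eq_zero a ha, tmul_zero]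
  · obtain ⟨s, hs⟩ := IsNoetherian.noetherian m
    let α : W →ₗ[R] (s → W) := LinearMap.pi fun a => LinearMap.lsmul R W (a : R)
    let K := Submodule.span R {w}
    have hKα : K = LinearMap.ker α := by
      apply le_antisymm
      · rw [Submodule.span_le, Set.singleton_subset_iff]
        exact funext fun a => hw.smul_eq_zero a (hs ▸ Submodule.subset_span a.2)
      · intro y hy
        obtain ⟨c, rfl⟩ := hw.mem_span y fun a ha => by
          rw [← hs] at ha
          refine Submodule.span_induction (p := fun a _ => a • y = 0) (fun a ha => ?_)
            (zero_smul _ _) (fun b c _ _ hb hc => by rw [add_smul, hb, hc, add_zero])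
            (fun c b _ hb => by rw [smul_assoc, hb, smul_zero]) ha
          exact congrFun hy ⟨a, ha⟩
        exact Submodule.smul_mem _ _ (Submodule.mem_span_singleton_self w)
    let β : (W ⧸ K) →ₗ[R] (s → W) := K.liftQ α hKα.le
    have hβ : Function.Injective β := by
      rw [← LinearMap.ker_eq_bot]
      exact Submodule.ker_liftQ_eq_bot _ _ _ hKα.ge
    have hαz : α.lTensor S z = 0 := by
      apply (TensorProduct.piRight R S S fun _ : s => W).injective
      rw [map_zero]
      funext a
      have hcomp : ∀ z : S ⊗[R] W, (TensorProduct.piRight R S S fun _ : s => W) (α.lTensor S z) a =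
          algebraMap R S a • z := by
        intro z
        induction z with
        | zero => simp
        | tmul b y => simp [α, piRightHom_tmul]
        | add y z hy hz => rw [map_add, map_add, Pi.add_apply, hy, hz, smul_add]
      rw [hcomp]
      exact hz _ (hS ▸ Ideal.mem_map_of_mem _ (hs ▸ Submodule.subset_span a.2))
    have hz0 : K.mkQ.lTensor S z = 0 := by
      refine hT _ _ β hβ ⟨N, fun a ha y => funext fun i => hN a ha _⟩ ?_
      rw [map_zero, ← LinearMap.comp_apply, ← LinearMap.lTensor_comp]
      rwa [Submodule.liftQ_mkQ]
    obtain ⟨y, rfl⟩ := (lTensor_exact S (LinearMap.exact_subtype_mkQ K) K.mkQ_surjective z).1 hz0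
    clear hz hαz hz0
    induction y with
    | zero => exact ⟨0, by simp⟩
    | tmul b y =>
      obtain ⟨y, hy⟩ := y
      obtain ⟨c, rfl⟩ := Submodule.mem_span_singleton.1 hy
      refine ⟨algebraMap R S c * b, ?_⟩
      simp [mul_smul, smul_tmul']
    | add y z hy hz =>
      obtain ⟨c, hc⟩ := hy
      obtain ⟨d, hd⟩ := hz
      exact ⟨c + d, by rw [map_add, hc, hd, add_smul]⟩

end FlatOnTorsion

section Lifting

theorem exists_linearMap_apply_eq_one {S M : Type*} [CommRing S] [IsLocalRing S]
    [IsNoetherianRing S] [AddCommGroup M] [Module S M] [Module.Finite S M] (e : M)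
    (h : ∀ N : ℕ, N ≠ 0 → ∃ ψ : M →ₗ[S] (S ⧸ maximalIdeal S ^ N), ψ e = 1) :
    ∃ φ : M →ₗ[S] S, φ e = 1 := by
  classical
  obtain ⟨a, π, hπ⟩ := Module.Finite.exists_fin' S M
  obtain ⟨s, hs⟩ := IsNoetherian.noetherian (LinearMap.ker π)
  let D : Module.Dual S (Fin a → S) →ₗ[S] (s → S) :=
    LinearMap.pi fun k => LinearMap.applyₗ (k : Fin a → S)
  obtain ⟨c, hc⟩ := (maximalIdeal S).exists_pow_inf_eq_pow_smul (LinearMap.range D)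
  obtain ⟨ψ, hψ⟩ := h (c + 1) (by omega)
  obtain ⟨l, hl⟩ := Module.projective_lifting_property (maximalIdeal S ^ (c + 1)).mkQ (ψ ∘ₗ π)
    (Submodule.mkQ_surjective _)
  have hl' (x : Fin a → S) : (maximalIdeal S ^ (c + 1)).mkQ (l x) = ψ (π x) :=
    LinearMap.congr_fun hl x
  have hDl : D l ∈ maximalIdeal S ^ (c + 1) • (⊤ : Submodule S (s → S)) := by
    rw [pi_eq_sum_univ' (D l)]
    refine Submodule.sum_mem _ fun k _ => Submodule.smul_mem_smul ?_ trivial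
    rw [← Ideal.Quotient.eq_zero_iff_mem]
    refine (hl' k).trans ?_
    have hk : π k = 0 := LinearMap.mem_ker.1 (hs ▸ Submodule.subset_span k.2)
    rw [hk, map_zero]
  have hDl2 : D l ∈ maximalIdeal S • LinearMap.range D := by
    have h1 := (hc (c + 1) (by omega)).le ⟨hDl, LinearMap.mem_range_self D l⟩
    rw [Nat.add_sub_cancel_left, pow_one] at h1
    exact Submodule.smul_mono le_rfl inf_le_right h1
  rw [← Submodule.map_top, ← Submodule.map_smul''] at hDl2
  obtain ⟨θ, hθ, hθl⟩ := hDl2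
  have hker : LinearMap.ker π ≤ LinearMap.ker (l - θ) := by
    rw [← hs, Submodule.span_le]
    intro k hk
    rw [SetLike.mem_coe, LinearMap.mem_ker, LinearMap.sub_apply, sub_eq_zero]
    exact (congrFun hθl ⟨k, hk⟩).symm
  obtain ⟨x, rfl⟩ := hπ e
  let φ : M →ₗ[S] S := (LinearMap.ker π).liftQ (l - θ) hker ∘ₗ
    (π.quotKerEquivOfSurjective hπ).symm.toLinearMap
  have hφ : φ (π x) = l x - θ x := by
    have : (π.quotKerEquivOfSurjective hπ).symm (π x) = Submodule.Quotient.mk x := by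
      rw [LinearEquiv.symm_apply_eq]; rfl
    simp only [φ, LinearMap.comp_apply, LinearEquiv.coe_coe, this]
    rfl
  have hθx : θ x ∈ maximalIdeal S := by
    have h1 : LinearMap.applyₗ x θ ∈
        (maximalIdeal S • (⊤ : Submodule S _)).map (LinearMap.applyₗ (R := S) (M₂ := S) x) :=
      Submodule.mem_map_of_mem hθ
    rw [Submodule.map_smul''] at h1
    refine Submodule.smul_le.2 (fun a ha y _ => ?_) h1
    exact Ideal.mul_mem_right _ _ ha
  have hlx : l x - 1 ∈ maximalIdeal S := by
    refine Ideal.pow_le_self (n := c + 1) (by omega) ?_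
    rw [← Ideal.Quotient.eq_zero_iff_mem, map_sub, sub_eq_zero]
    exact (hl' x).trans (hψ.trans (map_one _).symm)
  have hunit : IsUnit (φ (π x)) := by
    by_contra hn
    have : φ (π x) ∈ maximalIdeal S := hn
    have h2 := Ideal.sub_mem _ (Ideal.sub_mem _ this hlx) (neg_mem hθx)
    rw [hφ] at h2
    exact (Ideal.ne_top_iff_one _).1 (maximalIdeal.isMaximal S).ne_top (by convert h2 using 1; ring)
  obtain ⟨b, hb⟩ := hunit
  exact ⟨((b⁻¹ : Sˣ) : S) • φ, by rw [LinearMap.smul_apply, ← hb, smul_eq_mul, Units.inv_mul]⟩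

end Lifting

section Splitting

theorem smul_tensorProduct_eq_zero {R S W : Type*} [CommRing R] [CommRing S] [Algebra R S]
    [AddCommGroup W] [Module R W] {I : Ideal R} (hI : ∀ a ∈ I, ∀ w : W, a • w = 0) {b : S}
    (hb : b ∈ I.map (algebraMap R S)) (z : S ⊗[R] W) : b • z = 0 := by
  refine Submodule.span_induction (p := fun b _ => b • z = 0) ?_ (zero_smul _ _)
    (fun b c _ _ hb hc => by rw [add_smul, hb, hc, add_zero])
    (fun c b _ hb => by rw [smul_assoc, hb, smul_zero]) hb
  rintro _ ⟨a, ha, rfl⟩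
  rw [algebraMap_smul]
  induction z with
  | zero => exact smul_zero _
  | tmul s w => rw [← tmul_smul, hI a ha, tmul_zero]
  | add y z hy hz => rw [smul_add, hy, hz, add_zero]

theorem FlatOnTorsion.exists_linearMap_apply_one_eq_one {R R₁ : Type u} {S S₁ : Type v} [CommRing R]
    [CommRing R₁] [CommRing S] [CommRing S₁] [Algebra R R₁] [Algebra R S] [Algebra R S₁]
    [Algebra S S₁] [Algebra R₁ S₁] [IsScalarTower R S S₁] [IsScalarTower R R₁ S₁]
    [IsNoetherianRing R] [IsNoetherianRing R₁] [IsNoetherianRing S] [IsLocalRing S]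
    [Module.Finite S S₁] {m : Ideal R} [m.IsMaximal] {m₁ : Ideal R₁} [m₁.IsMaximal]
    (hT : FlatOnTorsion m S) (hT₁ : FlatOnTorsion m₁ S₁)
    (hS : m.map (algebraMap R S) = maximalIdeal S) (hS₁ : m₁.map (algebraMap R₁ S₁) ≠ ⊤)
    (hm : m₁ ≤ (m.map (algebraMap R R₁)).radical) (σ : R₁ →ₗ[R] R) (hσ : σ 1 = 1) :
    ∃ φ : S₁ →ₗ[S] S, φ 1 = 1 := by
  refine exists_linearMap_apply_eq_one 1 fun N hN => ?_
  obtain ⟨W, _, _, w, hw, hWN, hWfin, hWl⟩ := exists_isSocleGenerator_of_pow R m N hN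
  have hmap : maximalIdeal S ^ N = (m ^ N).map (algebraMap R S) := by rw [Ideal.map_pow, hS]
  have hRN : IsFiniteLength R (R ⧸ m ^ N) := Module.length_ne_top_iff.1
    (ne_top_of_le_ne_top (Module.length_ne_top_iff.2 hWfin) hWl)
  have hl : Module.length S (S ⧸ maximalIdeal S ^ N) ≤ Module.length S (S ⊗[R] W) := by
    rw [hT.length_eq hS hWfin hWN, hmap, (Ideal.qoutMapEquivTensorQout S).length_eq,
      hT.length_eq hS (N := N) hRN]
    · exact hWl
    · intro a ha y
      obtain ⟨y, rfl⟩ := Ideal.Quotient.mk_surjective y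
      exact Ideal.Quotient.eq_zero_iff_mem.2 (Ideal.mul_mem_right y _ ha)
  have hu := hT.isSocleGenerator hS hw hWN
  let Φ : S₁ →ₗ[S] (S ⊗[R] W) →ₗ[S] (S₁ ⊗[R] W) :=
    (LinearMap.liftBaseChangeEquiv S).toLinearMap ∘ₗ AlgebraTensorModule.mk R S S₁ W
  have h1 : (1 : R₁) ⊗ₜ[R] w ≠ 0 := fun h => hw.ne_zero <| by
    simpa [hσ] using congrArg (TensorProduct.lid R W) (congrArg (σ.rTensor W) h)
  have h2 : (1 : S₁) ⊗ₜ[R] w ≠ 0 := by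
    obtain ⟨k, hk⟩ := Ideal.exists_pow_le_of_le_radical_of_fg
      (hm.trans (Ideal.radical_pow _ hN).ge) (IsNoetherian.noetherian m₁)
    have h3 := hT₁.tmul_ne_zero hS₁ (N := k) (fun a ha y =>
      smul_tensorProduct_eq_zero hWN (Ideal.map_pow (algebraMap R R₁) m N ▸ hk ha) y) h1
    intro h
    refine h3 ((AlgebraTensorModule.cancelBaseChange R R₁ R₁ S₁ W).injective ?_)
    rw [AlgebraTensorModule.cancelBaseChange_tmul, one_smul, h, map_zero]
  refine hu.exists_linearMap_quotient hN
    (fun a ha z => smul_tensorProduct_eq_zero hWN (hmap ▸ ha) z) hl (P := S₁ ⊗[R] W)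
    (fun a ha z => ?_) Φ (x := 1)
    (hu.injective_of_apply_ne_zero (fun a ha z => smul_tensorProduct_eq_zero hWN (hmap ▸ ha) z) _
      ?_)
  · rw [← algebraMap_smul S₁ a z]
    refine smul_tensorProduct_eq_zero hWN ?_ z
    rw [IsScalarTower.algebraMap_eq R S S₁, ← Ideal.map_map, ← hmap]
    exact Ideal.mem_map_of_mem _ ha
  · have : Φ 1 (1 ⊗ₜ[R] w) = 1 ⊗ₜ[R] w := by simp [Φ]
    rwa [this]

end Splitting

section Frobenius

/-- A copy of `R`, to be viewed as an `R`-algebra via the Frobenius. -/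
def FrobeniusCopy (R : Type u) : Type u := R

instance (R : Type u) [CommRing R] : CommRing (FrobeniusCopy R) := inferInstanceAs (CommRing R)

instance (R : Type u) [CommRing R] [h : IsNoetherianRing R] : IsNoetherianRing (FrobeniusCopy R) :=
  h

instance (R : Type u) (S : Type v) [CommRing R] [CommRing S] [h : Algebra R S] :
    Algebra (FrobeniusCopy R) (FrobeniusCopy S) := h

theorem FlatOnTorsion.isFPure_of_map_eq {R : Type u} {S : Type v} [CommRing R] [CommRing S]
    [IsNoetherianRing R] [IsNoetherianRing S] [IsLocalRing S] [Algebra R S] {p : ℕ}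
    (hp : p.Prime) [CharP R p] [CharP S p] {m : Ideal R} [hm : m.IsMaximal]
    (hT : FlatOnTorsion m S) (hS : m.map (algebraMap R S) = maximalIdeal S)
    (hR : IsFPure p R) (hSf : IsFFinite p S) : IsFPure p S := by
  have := Fact.mk hp
  obtain ⟨σ, hσ, hσ1⟩ := hR
  obtain ⟨s, hs⟩ := hSf
  let _ : Algebra R (FrobeniusCopy R) := RingHom.toAlgebra (S := FrobeniusCopy R) (frobenius R p)
  let _ : Algebra S (FrobeniusCopy S) := RingHom.toAlgebra (S := FrobeniusCopy S) (frobenius S p)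
  let _ : Algebra R (FrobeniusCopy S) :=
    ((algebraMap S (FrobeniusCopy S)).comp (algebraMap R S)).toAlgebra
  have : IsScalarTower R S (FrobeniusCopy S) := .of_algebraMap_eq fun _ => rfl
  have : IsScalarTower R (FrobeniusCopy R) (FrobeniusCopy S) :=
    .of_algebraMap_eq fun r => ((algebraMap R S).map_frobenius p r).symm
  let m₁ : Ideal (FrobeniusCopy R) := m
  have : m₁.IsMaximal := hm
  have : Module.Finite S (FrobeniusCopy S) := by
    refine ⟨⟨s, top_le_iff.1 fun x _ => ?_⟩⟩
    obtain ⟨c, hc⟩ := hs x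
    rw [hc]
    exact Submodule.sum_mem (R := S) (M := FrobeniusCopy S) _ fun y hy =>
      Submodule.smul_mem (R := S) (M := FrobeniusCopy S) _ (c y) (Submodule.subset_span hy)
  have hS₁ : m.map (algebraMap R S) ≠ ⊤ := hS ▸ Ideal.IsMaximal.ne_top inferInstance
  have hT₁ : FlatOnTorsion m₁ (FrobeniusCopy S) := hT
  let σ' : FrobeniusCopy R →ₗ[R] R := { toFun := σ, map_add' := σ.map_add, map_smul' := hσ }
  obtain ⟨φ, hφ⟩ := hT.exists_linearMap_apply_one_eq_one hT₁ hS hS₁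
    (fun a ha => ⟨p, Ideal.mem_map_of_mem (algebraMap R (FrobeniusCopy R)) ha⟩) σ' hσ1
  exact ⟨φ.toAddMonoidHom, fun r x => φ.map_smul r x, hφ⟩

end Frobenius

section Polynomial

open Polynomial

theorem IsFPure.polynomial {R : Type*} [CommRing R] {p : ℕ} (hp : p.Prime) [CharP R p]
    (hR : IsFPure p R) : IsFPure p R[X] := by
  have := Fact.mk hp
  obtain ⟨φ, hφ, hφ1⟩ := hR
  have hex (g : R[X]) : ∃ h : R[X], ∀ n, h.coeff n = φ (g.coeff (n * p)) := by
    refine ⟨∑ i ∈ Finset.range (g.natDegree + 1), monomial i (φ (g.coeff (i * p))), fun n => ?_⟩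
    simp only [finsetSum_coeff, coeff_monomial, Finset.sum_ite_eq', Finset.mem_range]
    split_ifs with h
    · rfl
    · rw [coeff_eq_zero_of_natDegree_lt, map_zero]
      exact (by omega : g.natDegree < n).trans_le (Nat.le_mul_of_pos_right n hp.pos)
  choose ψ hψ using hex
  refine ⟨AddMonoidHom.mk' ψ fun f g => ext fun n => by simp [hψ], fun f g => ?_, ext fun n => ?_⟩
  · change ψ (f ^ p * g) = f * ψ g
    induction f using Polynomial.induction_on' with
    | add f₁ f₂ h₁ h₂ =>
      ext n
      rw [add_mul, coeff_add, ← h₁, ← h₂, add_pow_char, add_mul, hψ, hψ, hψ, coeff_add, map_add]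
    | monomial k a =>
      ext n
      rw [hψ, monomial_pow, ← C_mul_X_pow_eq_monomial, ← C_mul_X_pow_eq_monomial, mul_assoc,
        mul_assoc, coeff_C_mul, coeff_C_mul, hφ, coeff_X_pow_mul', coeff_X_pow_mul']
      by_cases h : k ≤ n
      · rw [if_pos h, if_pos (Nat.mul_le_mul_right p h), hψ, Nat.sub_mul]
      · rw [if_neg h, if_neg (fun h' => h (Nat.le_of_mul_le_mul_right h' hp.pos)), map_zero]
  · change (ψ 1).coeff n = (1 : R[X]).coeff n
    rw [hψ, coeff_one, coeff_one]
    by_cases h : n = 0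
    · simp [h, hφ1]
    · simp [h, hp.ne_zero]

end Polynomial

section PolynomialFlat

open Polynomial

variable {R A S Q : Type*} [CommRing R] [CommRing A] [CommRing S] [Algebra R A] [Algebra A S]
  [Algebra R S] [IsScalarTower R A S] [AddCommGroup Q] [Module R Q] [Module A Q]
  [IsScalarTower R A Q]

variable (R S Q) in
/-- The endomorphism `s ⊗ q ↦ a s ⊗ q - s ⊗ a q`. -/
noncomputable def smulSubSMul (a : A) : S ⊗[R] Q →ₗ[S] S ⊗[R] Q :=
  algebraMap A S a • LinearMap.id - (Algebra.lsmul R R Q a).baseChange S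

@[simp]
theorem smulSubSMul_tmul (a : A) (s : S) (q : Q) :
    smulSubSMul R S Q a (s ⊗ₜ q) = (a • s) ⊗ₜ q - s ⊗ₜ (a • q) := by
  simp [smulSubSMul, smul_tmul', Algebra.smul_def]

theorem smulSubSMul_lTensor {P : Type*} [AddCommGroup P] [Module R P] [Module A P]
    [IsScalarTower R A P] (f : P →ₗ[A] Q) (a : A) (z : S ⊗[R] P) :
    smulSubSMul R S Q a ((f.restrictScalars R).lTensor S z) =
      (f.restrictScalars R).lTensor S (smulSubSMul R S P a z) := by
  induction z with
  | zero => simp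
  | tmul s y => simp [map_sub]
  | add y z hy hz => simp only [map_add, hy, hz]

theorem mem_range_smulSubSMul_X [Algebra R[X] S] [IsScalarTower R R[X] S] [Module R[X] Q]
    [IsScalarTower R R[X] Q] (z : S ⊗[R] Q) (hz : mapOfCompatibleSMul R[X] R R[X] S Q z = 0) :
    z ∈ LinearMap.range (smulSubSMul R S Q (X : R[X])) := by
  have hker : z ∈ LinearMap.ker (mapOfCompatibleSMul R[X] R R[X] S Q) := hz
  rw [AlgebraTensorModule.ker_mapOfCompatibleSMul] at hker
  refine (Submodule.span_le (p := (LinearMap.range (smulSubSMul R S Q (X : R[X]))).restrictScalars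
    R[X])).2 ?_ hker
  rintro _ ⟨a, s, q, rfl⟩
  change _ ∈ LinearMap.range (smulSubSMul R S Q (X : R[X]))
  induction a using Polynomial.induction_on generalizing s q with
  | C r =>
    rw [show (C r : R[X]) = algebraMap R R[X] r from rfl, algebraMap_smul, algebraMap_smul,
      smul_tmul, sub_self]
    exact Submodule.zero_mem _
  | add f g hf hg =>
    convert Submodule.add_mem _ (hf s q) (hg s q) using 1
    rw [add_smul, add_smul, add_tmul, tmul_add]
    abel
  | monomial n r h =>
    convert Submodule.add_mem _ (LinearMap.mem_range_self (smulSubSMul R S Q (X : R[X]))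
      (((C r * X ^ n : R[X]) • s) ⊗ₜ q)) (h s ((X : R[X]) • q)) using 1
    rw [smulSubSMul_tmul, smul_smul, smul_smul, pow_succ, mul_assoc, mul_comm X (C r * X ^ n),
      mul_assoc]
    abel

theorem mapOfCompatibleSMul_smulSubSMul (a : A) (z : S ⊗[R] Q) :
    mapOfCompatibleSMul A R A S Q (smulSubSMul R S Q a z) = 0 := by
  induction z with
  | zero => simp
  | tmul s y => rw [smulSubSMul_tmul, map_sub, mapOfCompatibleSMul_tmul, mapOfCompatibleSMul_tmul,
      smul_tmul, sub_self]
  | add y z hy hz => rw [map_add, map_add, hy, hz, add_zero]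

theorem smul_tensorProduct_injective {m : Ideal R} [m.IsMaximal] {C : Type*} [AddCommGroup C]
    [Module R C] (hC : ∀ a ∈ m, ∀ c : C, a • c = 0) {x : S}
    (hx : ∀ s : S, x * s ∈ m.map (algebraMap R S) → s ∈ m.map (algebraMap R S))
    {z : S ⊗[R] C} (hz : x • z = 0) : z = 0 := by
  let k := R ⧸ m
  let _ : Field k := Ideal.Quotient.field m
  have hCt : Module.IsTorsionBySet R C m := fun c a => hC a a.2 c
  let _ : Module k C := hCt.module
  have : IsScalarTower R k C := hCt.isScalarTower
  let μ : S →ₗ[R] S := LinearMap.mulLeft R x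
  have h1 : Function.Injective (μ.lTensor k) := by
    rw [injective_iff_map_eq_zero]
    intro y hy
    let e : k ⊗[R] S ≃ₗ[R] (S ⧸ m.map (algebraMap R S)) :=
      TensorProduct.comm R k S ≪≫ₗ (Ideal.qoutMapEquivTensorQout S).symm.restrictScalars R
    have he : ∀ y : k ⊗[R] S, e (μ.lTensor k y) = x • e y := by
      intro y
      induction y with
      | zero => simp
      | tmul a s =>
        change (Ideal.qoutMapEquivTensorQout S).symm ((x * s) ⊗ₜ a) =
          x • (Ideal.qoutMapEquivTensorQout S).symm (s ⊗ₜ a)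
        rw [← map_smul, smul_tmul', smul_eq_mul]
      | add y z hy hz => rw [map_add, map_add, hy, hz, map_add, smul_add]
    have h2 : x • e y = 0 := by rw [← he, hy, map_zero]
    obtain ⟨s, hs⟩ := Ideal.Quotient.mk_surjective (e y)
    rw [← hs] at h2
    have h3 := hx s (Ideal.Quotient.eq_zero_iff_mem.1 h2)
    apply e.injective
    rw [map_zero, ← hs, Ideal.Quotient.eq_zero_iff_mem.2 h3]
  have h2 : Function.Injective ((μ.baseChange k).lTensor C) :=
    Module.Flat.lTensor_preserves_injective_linearMap _
      (by rw [LinearMap.baseChange_eq_ltensor]; exact h1)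
  let e := AlgebraTensorModule.cancelBaseChange R k k C S
  have he : ∀ y, e ((μ.baseChange k).lTensor C y) = μ.lTensor C (e y) := by
    intro y
    induction y with
    | zero => simp
    | tmul c y =>
      induction y with
      | zero => simp
      | tmul a s => simp [e]
      | add y z hy hz => rw [tmul_add, map_add, map_add, hy, hz, map_add, map_add]
    | add y z hy hz => rw [map_add, map_add, hy, hz, map_add, map_add]
  have h3 : μ.lTensor C (TensorProduct.comm R S C z) = 0 := by
    rw [← map_zero (TensorProduct.comm R S C), ← hz]
    generalize z = z
    induction z with
    | zero => simp
    | tmul s c => simp [μ, smul_tmul']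
    | add y z hy hz => rw [map_add, map_add, hy, hz, smul_add, map_add]
  apply (TensorProduct.comm R S C).injective
  apply e.symm.injective
  apply h2
  apply e.injective
  rw [he, e.apply_symm_apply, h3]
  simp

end PolynomialFlat

section PolynomialFlatOnTorsion

open Polynomial

variable {R : Type u} {S : Type v} [CommRing R] [CommRing S] [Algebra R S] [Algebra R[X] S]
  [IsScalarTower R R[X] S] {m : Ideal R}

theorem smul_eq_zero_of_mem_pow {Q : Type*} [AddCommGroup Q] [Module R Q] [Module R[X] Q]
    [IsScalarTower R R[X] Q] {N : ℕ} (hQ : ∀ a ∈ (m.map C ⊔ Ideal.span {X}) ^ N, ∀ y : Q, a • y = 0)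
    {a : R} (ha : a ∈ m ^ N) (y : Q) : a • y = 0 := by
  rw [← algebraMap_smul R[X] a y]
  refine hQ _ (Ideal.pow_right_mono le_sup_left N ?_) y
  rw [← Ideal.map_pow]
  exact Ideal.mem_map_of_mem _ ha

theorem FlatOnTorsion.eq_zero_of_smulSubSMul_X_eq_zero [m.IsMaximal] (hT : FlatOnTorsion m S)
    (hx : ∀ s : S, algebraMap R[X] S X * s ∈ m.map (algebraMap R S) → s ∈ m.map (algebraMap R S))
    {Q : Type u} [AddCommGroup Q] [Module R Q] [Module R[X] Q] [IsScalarTower R R[X] Q] {N : ℕ}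
    (hQ : ∀ a ∈ (m.map C ⊔ Ideal.span {X}) ^ N, ∀ y : Q, a • y = 0) {z : S ⊗[R] Q}
    (hz : smulSubSMul R S Q (X : R[X]) z = 0) : z = 0 := by
  induction N generalizing Q with
  | zero =>
    have : Subsingleton Q := subsingleton_of_forall_eq 0 fun y => by simpa using hQ 1 (by simp) y
    exact Subsingleton.elim _ _
  | succ N ih =>
    let M : Ideal R[X] := m.map C ⊔ Ideal.span {X}
    let K : Submodule R[X] Q := M • ⊤
    have hK : ∀ a ∈ M ^ N, ∀ y : K, a • y = 0 := by
      rintro a ha ⟨y, hy⟩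
      ext
      change a • y = 0
      refine Submodule.smul_induction_on hy (fun b hb q _ => ?_) fun x y hx hy => by
        rw [smul_add, hx, hy, add_zero]
      rw [smul_smul]
      exact hQ _ (by rw [pow_succ]; exact Ideal.mul_mem_mul ha hb) q
    have hQK : ∀ a ∈ M, ∀ y : Q ⧸ K, a • y = 0 := by
      intro a ha y
      obtain ⟨y, rfl⟩ := K.mkQ_surjective y
      rw [← map_smul]
      exact (Submodule.Quotient.mk_eq_zero K).2 (Submodule.smul_mem_smul ha trivial)
    have hquot (y : S ⊗[R] (Q ⧸ K)) (hy : smulSubSMul R S (Q ⧸ K) (X : R[X]) y = 0) : y = 0 := by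
      refine smul_tensorProduct_injective (m := m) (fun a ha c => ?_) hx (z := y) ?_
      · exact smul_eq_zero_of_mem_pow (N := 1) (by rwa [pow_one]) (by rwa [pow_one]) c
      · rw [← hy]
        generalize y = y
        induction y with
        | zero => simp
        | tmul s c =>
          rw [smulSubSMul_tmul, hQK X (Ideal.mem_sup_right (Ideal.mem_span_singleton_self X)),
            tmul_zero, sub_zero, smul_tmul', smul_eq_mul, Algebra.smul_def]
        | add y z hy hz => rw [map_add, smul_add, hy, hz]
    have h1 : (K.mkQ.restrictScalars R).lTensor S z = 0 := by
      apply hquot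
      rw [smulSubSMul_lTensor, hz, map_zero]
    obtain ⟨z, rfl⟩ := (lTensor_exact S (f := K.subtype.restrictScalars R)
      (g := K.mkQ.restrictScalars R) (LinearMap.exact_subtype_mkQ K) K.mkQ_surjective z).1 h1
    rw [smulSubSMul_lTensor] at hz
    rw [ih hK (hT _ _ (K.subtype.restrictScalars R) K.subtype_injective
      ⟨N + 1, fun a ha y => smul_eq_zero_of_mem_pow hQ ha y⟩
      (hz.trans (map_zero _).symm)), map_zero]

theorem FlatOnTorsion.polynomial [m.IsMaximal] (hT : FlatOnTorsion m S)
    (hx : ∀ s : S, algebraMap R[X] S X * s ∈ m.map (algebraMap R S) → s ∈ m.map (algebraMap R S)) :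
    FlatOnTorsion (m.map C ⊔ Ideal.span {X}) S := by
  intro P Q _ _ _ _ f hf ⟨N, hN⟩
  let _ : Module R P := Module.compHom P (algebraMap R R[X])
  let _ : Module R Q := Module.compHom Q (algebraMap R R[X])
  have : IsScalarTower R R[X] P := .of_compHom R R[X] P
  have : IsScalarTower R R[X] Q := .of_compHom R R[X] Q
  let fR := f.restrictScalars R
  have hfR : Function.Injective (fR.lTensor S) :=
    hT _ _ fR hf ⟨N, fun a ha y => smul_eq_zero_of_mem_pow hN ha y⟩
  rw [injective_iff_map_eq_zero]
  intro z hz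
  obtain ⟨z, rfl⟩ := mapOfCompatibleSMul_surjective R[X] R R[X] S P z
  have h1 : mapOfCompatibleSMul R[X] R R[X] S Q (fR.lTensor S z) = 0 := by
    rw [← hz]
    generalize z = z
    induction z with
    | zero => simp
    | tmul s y => simp [fR]
    | add y z hy hz => simp only [map_add, hy, hz]
  obtain ⟨t, ht⟩ := mem_range_smulSubSMul_X _ h1
  let K := LinearMap.range f
  have h2 : (K.mkQ.restrictScalars R).lTensor S t = 0 := by
    refine hT.eq_zero_of_smulSubSMul_X_eq_zero hx (N := N) (fun a ha y => ?_) ?_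
    · obtain ⟨y, rfl⟩ := K.mkQ_surjective y
      rw [← map_smul, hN a ha, map_zero]
    · rw [smulSubSMul_lTensor, ht, ← LinearMap.comp_apply, ← LinearMap.lTensor_comp]
      have : K.mkQ.restrictScalars R ∘ₗ fR = 0 :=
        LinearMap.ext fun y => (Submodule.Quotient.mk_eq_zero K).2 (LinearMap.mem_range_self f y)
      rw [this, LinearMap.lTensor_zero, LinearMap.zero_apply]
  obtain ⟨t, rfl⟩ := (lTensor_exact S (f := fR) (g := K.mkQ.restrictScalars R)
    (LinearMap.exact_map_mkQ_range f) K.mkQ_surjective t).1 h2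
  rw [smulSubSMul_lTensor] at ht
  rw [← hfR ht, mapOfCompatibleSMul_smulSubSMul]

end PolynomialFlatOnTorsion

section RegularSequence

/-- `I` is contained in an ideal chain, each step adding one element that is a nonzerodivisor modulo
the previous ideal, which ends in the maximal ideal. -/
inductive IsRegularlyCompletable {S : Type*} [CommRing S] [IsLocalRing S] : Ideal S → Prop
  | maximalIdeal : IsRegularlyCompletable (maximalIdeal S)
  | of_sup_span (I : Ideal S) (x : S) : (∀ s, x * s ∈ I → s ∈ I) →
      IsRegularlyCompletable (I ⊔ Ideal.span {x}) → IsRegularlyCompletable I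

open Polynomial in
theorem isMaximal_map_C_sup_span_X {R : Type*} [CommRing R] (m : Ideal R) [m.IsMaximal] :
    (m.map C ⊔ Ideal.span {(X : R[X])}).IsMaximal := by
  have h : m.map C ⊔ Ideal.span {(X : R[X])} = m.comap (evalRingHom 0) := by
    refine le_antisymm (sup_le (Ideal.map_le_iff_le_comap.2 fun a ha => ?_)
      ((Ideal.span_singleton_le_iff_mem _).2 ?_)) fun f hf => ?_
    · simpa using ha
    · simp
    · rw [← f.divX_mul_X_add]
      have h0 : f.coeff 0 ∈ m := by simpa [coeff_zero_eq_eval_zero] using hf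
      exact add_mem (Ideal.mem_sup_right (Ideal.mul_mem_left _ _ (Ideal.mem_span_singleton_self X)))
        (Ideal.mem_sup_left (Ideal.mem_map_of_mem C h0))
  rw [h]
  exact Ideal.comap_isMaximal_of_surjective _ fun r => ⟨C r, by simp⟩

open Polynomial in
theorem IsRegularlyCompletable.isFPure {S : Type v} [CommRing S] [IsLocalRing S]
    [IsNoetherianRing S] {p : ℕ} (hp : p.Prime) [CharP S p] (hSf : IsFFinite p S) {I : Ideal S}
    (hI : IsRegularlyCompletable I) {R : Type u} [CommRing R] [IsNoetherianRing R] [CharP R p]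
    [Algebra R S] {m : Ideal R} [m.IsMaximal] (hT : FlatOnTorsion m S)
    (hm : m.map (algebraMap R S) = I) (hR : IsFPure p R) : IsFPure p S := by
  induction hI generalizing R with
  | maximalIdeal => exact hT.isFPure_of_map_eq hp hm hR hSf
  | of_sup_span I x hx _ ih =>
    let _ : Algebra R[X] S := (aeval x).toRingHom.toAlgebra
    have hX : algebraMap R[X] S X = x := aeval_X x
    have : IsScalarTower R R[X] S := .of_algebraMap_eq fun r => (aeval_C x r).symm
    have := isMaximal_map_C_sup_span_X m
    subst hm
    refine ih (R := R[X]) (hT.polynomial fun s hs => hx s (by rwa [hX] at hs)) ?_ (hR.polynomial hp)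
    rw [Ideal.map_sup, Ideal.map_map, Ideal.map_span, Set.image_singleton, hX,
      IsScalarTower.algebraMap_eq R R[X] S]
    rfl

end RegularSequence

section Regular

variable {S : Type*} [CommRing S] [IsLocalRing S]

theorem exists_erase_sup_span_eq_maximalIdeal [DecidableEq S] {I : Ideal S} {s : Finset S}
    (hs : I ⊔ Ideal.span s = maximalIdeal S) {x : S} (hx : x ∈ maximalIdeal S)
    (hx2 : x ∉ I ⊔ maximalIdeal S ^ 2) :
    ∃ y ∈ s, I ⊔ Ideal.span {x} ⊔ Ideal.span (s.erase y : Finset S) = maximalIdeal S := by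
  have hsn : ∀ y ∈ s, y ∈ maximalIdeal S := fun y hy =>
    hs ▸ Ideal.mem_sup_right (Ideal.subset_span hy)
  have hx' := hx
  rw [← hs] at hx'
  obtain ⟨i, hi, z, hz, hiz⟩ := Submodule.mem_sup.1 hx'
  obtain ⟨c, -, rfl⟩ := Submodule.mem_span_finset.1 hz
  obtain ⟨y, hy, hcy⟩ : ∃ y ∈ s, c y ∉ maximalIdeal S := by
    by_contra! hc
    refine hx2 (hiz ▸ Submodule.add_mem_sup hi (Submodule.sum_mem _ fun y hy => ?_))
    rw [smul_eq_mul, sq]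
    exact Ideal.mul_mem_mul (hc y hy) (hsn y hy)
  refine ⟨y, hy, ?_⟩
  set J := I ⊔ Ideal.span {x} ⊔ Ideal.span (s.erase y : Finset S)
  have herase : ∀ t ∈ s.erase y, t ∈ J := fun t ht => Ideal.mem_sup_right (Ideal.subset_span ht)
  have hIJ : I ≤ J := le_sup_left.trans le_sup_left
  have hxJ : x ∈ J := Ideal.mem_sup_left (Ideal.mem_sup_right (Ideal.mem_span_singleton_self x))
  have hyJ : y ∈ J := by
    have hcyJ : c y * y ∈ J := by
      rw [← Finset.add_sum_erase _ _ hy, smul_eq_mul] at hiz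
      rw [show c y * y = x - i - ∑ t ∈ s.erase y, c t • t by rw [← hiz]; ring]
      exact sub_mem (sub_mem hxJ (hIJ hi))
        (Submodule.sum_mem _ fun t ht => J.smul_mem _ (herase t ht))
    exact (Ideal.unit_mul_mem_iff_mem J (notMem_maximalIdeal.1 hcy)).1 hcyJ
  refine le_antisymm (sup_le (sup_le (hs ▸ le_sup_left) ?_) ?_)
    (hs ▸ sup_le hIJ (Ideal.span_le.2 fun t ht => ?_))
  · rwa [Ideal.span_singleton_le_iff_mem]
  · exact Ideal.span_le.2 fun t ht => hsn t (Finset.mem_of_mem_erase ht)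
  · obtain rfl | hty := eq_or_ne t y
    · exact hyJ
    · exact herase t (Finset.mem_erase.2 ⟨hty, ht⟩)

theorem not_maximalIdeal_le_of_mem_minimalPrimes {I q : Ideal S} (hq : q ∈ I.minimalPrimes)
    (hd : 0 < ringKrullDim (S ⧸ I)) : ¬ maximalIdeal S ≤ q := by
  intro hle
  have h0 : Ring.KrullDimLE 0 (S ⧸ I) := by
    refine Ideal.krullDimLE_zero_quotient_iff_forall_minimalPrimes_isMaximal.2 fun J hJ => ?_
    have hJn : maximalIdeal S ≤ J :=
      hle.trans (hq.2 hJ.1 ((le_maximalIdeal hJ.1.1.ne_top).trans hle))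
    rw [← (maximalIdeal.isMaximal S).eq_of_le hJ.1.1.ne_top hJn]
    infer_instance
  exact absurd (Ring.krullDimLE_iff.1 h0) (by simpa using hd)

theorem ringKrullDim_quotient_le_ringKrullDim_quotient_sup_span [IsNoetherianRing S] {I : Ideal S}
    (hI : I ≤ maximalIdeal S) {x : S} (hx : x ∈ maximalIdeal S) :
    ringKrullDim (S ⧸ I) ≤ ringKrullDim (S ⧸ I ⊔ Ideal.span {x}) + 1 := by
  have : Nontrivial (S ⧸ I) :=
    Ideal.Quotient.nontrivial_iff.2 (ne_top_of_le_ne_top Ideal.IsPrime.ne_top' hI)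
  have : IsLocalRing (S ⧸ I) := .of_surjective' _ Ideal.Quotient.mk_surjective
  have hmem : Ideal.Quotient.mk I x ∈ maximalIdeal (S ⧸ I) := by
    have := IsLocalHom.of_surjective (Ideal.Quotient.mk I) Ideal.Quotient.mk_surjective
    exact map_nonunit (Ideal.Quotient.mk I) x hx
  have h := ringKrullDim_le_ringKrullDim_quotient_add_card {Ideal.Quotient.mk I x}
    (by simpa [ringJacobson_eq_maximalIdeal] using hmem)
  rw [Finset.coe_singleton, ← Set.image_singleton, ← Ideal.map_span,
    ringKrullDim_eq_of_ringEquiv (DoubleQuot.quotQuotEquivQuotSup I (Ideal.span {x}))] at h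
  simpa using h

theorem isPrime_and_isRegularlyCompletable [IsNoetherianRing S] {I : Ideal S} {s : Finset S}
    (hs : I ⊔ Ideal.span s = maximalIdeal S) (hd : (s.card : WithBot ℕ∞) ≤ ringKrullDim (S ⧸ I)) :
    I.IsPrime ∧ IsRegularlyCompletable I := by
  classical
  induction h : s.card generalizing I s with
  | zero =>
    rw [Finset.card_eq_zero.1 h, Finset.coe_empty, Ideal.span_empty, sup_bot_eq] at hs
    rw [hs]
    exact ⟨inferInstance, .maximalIdeal⟩
  | succ d ih =>
    have hI : I ≤ maximalIdeal S := hs ▸ le_sup_left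
    have hd0 : 0 < ringKrullDim (S ⧸ I) := by
      refine lt_of_lt_of_le ?_ hd
      rw [h]
      norm_cast
      omega
    obtain ⟨x, hxn, hx⟩ : ∃ x ∈ maximalIdeal S, x ∉ I ⊔ maximalIdeal S ^ 2 ∧
        ∀ q ∈ I.minimalPrimes, x ∉ q := by
      by_contra! hcon
      have hsub : (maximalIdeal S : Set S) ⊆
          ⋃ J ∈ insert (I ⊔ maximalIdeal S ^ 2) I.minimalPrimes, ((id J : Ideal S) : Set S) := by
        intro x hx
        by_cases hx2 : x ∈ I ⊔ maximalIdeal S ^ 2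
        · exact Set.mem_biUnion (Set.mem_insert _ _) hx2
        · obtain ⟨q, hq, hxq⟩ := hcon x hx hx2
          exact Set.mem_biUnion (Set.mem_insert_of_mem _ hq) hxq
      rw [Ideal.subset_union_prime_finite
        ((Ideal.finite_minimalPrimes_of_isNoetherianRing S I).insert _)
        (I ⊔ maximalIdeal S ^ 2) (I ⊔ maximalIdeal S ^ 2)] at hsub
      · have hq : ∃ q ∈ I.minimalPrimes, maximalIdeal S ≤ q := by
          obtain ⟨J, rfl | hJ, hle⟩ := hsub
          · obtain ⟨q, hq, -⟩ := Ideal.exists_minimalPrimes_le hI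
            refine ⟨q, hq, le_trans ?_ hq.1.2⟩
            refine Submodule.le_of_le_smul_of_le_jacobson_bot (I := maximalIdeal S)
              (IsNoetherian.noetherian _) (maximalIdeal_le_jacobson ⊥) ?_
            rwa [smul_eq_mul, ← sq]
          · exact ⟨J, hJ, hle⟩
        obtain ⟨q, hq, hle⟩ := hq
        exact not_maximalIdeal_le_of_mem_minimalPrimes hq hd0 hle
      · rintro J (rfl | hJ) h1 _
        · exact absurd rfl h1
        · exact hJ.1.1
    obtain ⟨hx2, hxq⟩ := hx
    obtain ⟨y, hy, hsy⟩ := exists_erase_sup_span_eq_maximalIdeal hs hxn hx2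
    have hcard : (s.erase y).card = d := by rw [Finset.card_erase_of_mem hy, h]; rfl
    obtain ⟨hJ, hrJ⟩ := ih hsy (by
      rw [hcard, ← ENat.WithBot.add_le_add_one_right_iff]
      refine le_trans ?_ (ringKrullDim_quotient_le_ringKrullDim_quotient_sup_span hI hxn)
      exact_mod_cast h ▸ hd) hcard
    obtain ⟨q, hq, hqJ⟩ := Ideal.exists_minimalPrimes_le (I := I)
      (J := I ⊔ Ideal.span {x}) le_sup_left
    have := hq.1.1
    have hqI : q ≤ I := by
      refine Submodule.le_of_le_smul_of_le_jacobson_bot (I := maximalIdeal S)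
        (IsNoetherian.noetherian _) (maximalIdeal_le_jacobson ⊥) fun z hz => ?_
      obtain ⟨i, hi, w, hw, rfl⟩ := Submodule.mem_sup.1 (hqJ hz)
      obtain ⟨t, rfl⟩ := Ideal.mem_span_singleton'.1 hw
      have htx : t * x ∈ q := (Submodule.add_mem_iff_right _ (hq.1.2 hi)).1 hz
      have ht : t ∈ q := (this.mem_or_mem htx).resolve_right (hxq q hq)
      rw [mul_comm]
      exact Submodule.add_mem_sup hi (Submodule.smul_mem_smul hxn ht)
    obtain rfl : q = I := le_antisymm hqI hq.1.2
    exact ⟨this, .of_sup_span _ x (fun t ht => (this.mem_or_mem ht).resolve_left (hxq _ hq)) hrJ⟩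

theorem IsRegularLocal.isRegularlyCompletable [IsNoetherianRing S] {I : Ideal S}
    (hI : IsRegularLocal (S ⧸ I)) : IsRegularlyCompletable I := by
  classical
  obtain ⟨-, _, s, hs, hd⟩ := hI
  have hsurj : Function.Surjective (Ideal.Quotient.mk I) := Ideal.Quotient.mk_surjective
  have := IsLocalHom.of_surjective (Ideal.Quotient.mk I) hsurj
  let g := Function.surjInv hsurj
  have himg : Ideal.Quotient.mk I '' (s.image g : Finset S) = s := by
    rw [Finset.coe_image, Set.image_image]
    simp [g, Function.surjInv_eq hsurj]
  refine (isPrime_and_isRegularlyCompletable (s := s.image g) ?_ ?_).2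
  · rw [← Ideal.comap_map_quotientMk, Ideal.map_span, himg, hs,
      jacobson_eq_maximalIdeal ⊥ bot_ne_top]
    exact maximalIdeal_comap (Ideal.Quotient.mk I)
  · have hd' : (s.card : WithBot ℕ∞) ≤ ringKrullDim (S ⧸ I) := hd.le
    refine le_trans ?_ hd'
    exact_mod_cast Finset.card_image_le

end Regular

theorem Module.Flat.flatOnTorsion {R : Type u} {S : Type v} [CommRing R] [AddCommGroup S]
    [Module R S] [Module.Flat R S] (m : Ideal R) : FlatOnTorsion m S :=
  fun _ _ _ _ _ _ f hf _ => Module.Flat.lTensor_preserves_injective_linearMap f hf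

end FlatFrobenius

/-- If `(R,𝔪) → (S,𝔫)` is a flat local homomorphism of `F`-finite Noetherian local rings
of prime characteristic `p` whose closed fiber `S/𝔪S` is a regular local ring, and `R` is
`F`-pure, then `S` is `F`-pure. -/
theorem fPure_of_flat_local_regular_closed_fiber (R S : Type*) [CommRing R] [CommRing S]
    [IsLocalRing R] [IsLocalRing S] [IsNoetherianRing R] [IsNoetherianRing S]
    (p : ℕ) (hp : p.Prime) [CharP R p] [CharP S p]
    (hFFR : IsFFinite p R) (hFFS : IsFFinite p S)
    [Algebra R S] [IsLocalHom (algebraMap R S)] [Module.Flat R S]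
    (hreg : IsRegularLocal (S ⧸ Ideal.map (algebraMap R S) (IsLocalRing.maximalIdeal R)))
    (hFP : IsFPure p R) :
    IsFPure p S :=
  hreg.isRegularlyCompletable.isFPure hp hFFS (Module.Flat.flatOnTorsion _) rfl hFP
end
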